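/- Let Λ be a semi-stable net of quadrics in a,b,c,d,e with basis (Q1,Q2,Q3). If the discriminant Δ = det(xA1+yA2+zA3) ∈ ℂ[x,y,z] is not squarefree (i.e. Δ is divisible by the square of some nonconstant polynomial), then the ideal (Q1,Q2,Q3) ⊆ ℂ[a,b,c,d,e] is not a radical ideal (the curve defined by the net is non-reduced). -/

import Mathlib

open MvPolynomial

/-- The space of polynomials in the five variables `a,b,c,d,e` (indexed `0,…,4`). -/
abbrev Quin : Type := MvPolynomial (Fin 5) ℂ

/-- `m` is (the exponent vector of) a quadratic monomial. -/
def QuadMon (m : Fin 5 →₀ ℕ) : Prop := (m.sum fun _ n => n) = 2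

/-- A net of quadrics: a 3-dimensional space of quadratic forms. -/
def IsNet (Λ : Submodule ℂ Quin) : Prop :=
  Module.finrank ℂ Λ = 3 ∧ ∀ Q ∈ Λ, MvPolynomial.IsHomogeneous Q 2

/-- The `ρ`-weight of a monomial. -/
def wt (ρ : Fin 5 → ℤ) (m : Fin 5 →₀ ℕ) : ℤ := ∑ i, (m i : ℤ) * ρ i

/-- `Λ` is semistable with respect to the weight vector `ρ`: there are three distinct
quadratic monomials with total `ρ`-weight `≥ 0` such that the corresponding coefficient
map `Λ → ℂ³` is bijective. -/
def SemistableWrt (Λ : Submodule ℂ Quin) (ρ : Fin 5 → ℤ) : Prop :=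
  ∃ m1 m2 m3 : Fin 5 →₀ ℕ, m1 ≠ m2 ∧ m1 ≠ m3 ∧ m2 ≠ m3 ∧
    QuadMon m1 ∧ QuadMon m2 ∧ QuadMon m3 ∧
    0 ≤ wt ρ m1 + wt ρ m2 + wt ρ m3 ∧
    Function.Bijective (fun Q : Λ =>
      (![MvPolynomial.coeff m1 (Q : Quin), MvPolynomial.coeff m2 (Q : Quin),
         MvPolynomial.coeff m3 (Q : Quin)] : Fin 3 → ℂ))

/-- The twelve distinguished weight vectors `ρ1,…,ρ12`. -/
def rho : Fin 12 → Fin 5 → ℤ :=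
  ![![1,1,1,1,-4], ![2,2,2,-3,-3], ![3,3,-2,-2,-2], ![4,-1,-1,-1,-1],
    ![3,3,3,-2,-7], ![4,4,-1,-1,-6], ![9,4,-1,-6,-6], ![7,2,2,-3,-8],
    ![12,7,2,-8,-13], ![9,4,-1,-1,-11], ![14,4,-1,-6,-11], ![13,8,3,-7,-17]]

/-- A normalized weight vector: nonincreasing, sums to zero and not identically zero. -/
def IsNormalized (ρ : Fin 5 → ℤ) : Prop :=
  (∀ i j : Fin 5, i ≤ j → ρ j ≤ ρ i) ∧ (∑ i, ρ i) = 0 ∧ ρ ≠ 0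

/-- Linear substitution of variables by the matrix `g`, as a linear map on polynomials. -/
noncomputable def substMap (g : Matrix (Fin 5) (Fin 5) ℂ) : Quin →ₗ[ℂ] Quin :=
  (MvPolynomial.aeval fun i => ∑ j, MvPolynomial.C (g i j) * MvPolynomial.X j).toLinearMap

/-- Semistability of a net (Hilbert–Mumford criterion for `SL(5)`). -/
def Semistable (Λ : Submodule ℂ Quin) : Prop :=
  ∀ (g : Matrix.GeneralLinearGroup (Fin 5) ℂ) (ρ : Fin 5 → ℤ), IsNormalized ρ →
    SemistableWrt (Submodule.map (substMap (g : Matrix (Fin 5) (Fin 5) ℂ)) Λ) ρ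

/-- The symmetric matrix of a quadratic form. -/
noncomputable def quadMatrix (Q : Quin) : Matrix (Fin 5) (Fin 5) ℂ :=
  Matrix.of fun i j =>
    if i = j then MvPolynomial.coeff (Finsupp.single i 2) Q
    else (1/2) * MvPolynomial.coeff (Finsupp.single i 1 + Finsupp.single j 1) Q

/-- The discriminant quintic `det (x·A1 + y·A2 + z·A3)` of a net with basis `Q1,Q2,Q3`. -/
noncomputable def netDisc (Q1 Q2 Q3 : Quin) : MvPolynomial (Fin 3) ℂ :=
  Matrix.det (Matrix.of fun i j : Fin 5 =>
    MvPolynomial.C (quadMatrix Q1 i j) * MvPolynomial.X 0 +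
    MvPolynomial.C (quadMatrix Q2 i j) * MvPolynomial.X 1 +
    MvPolynomial.C (quadMatrix Q3 i j) * MvPolynomial.X 2)

/-- The net lies on a smooth quartic del Pezzo surface. -/
def OnSmoothDelPezzo (Λ : Submodule ℂ Quin) : Prop :=
  ∃ P1 P2 : Quin, P1 ∈ Λ ∧ P2 ∈ Λ ∧ LinearIndependent ℂ ![P1, P2] ∧
    ∀ v : Fin 5 → ℂ, v ≠ 0 → MvPolynomial.eval v P1 = 0 → MvPolynomial.eval v P2 = 0 →
      LinearIndependent ℂ
        ![fun i => MvPolynomial.eval v (MvPolynomial.pderiv i P1),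
          fun i => MvPolynomial.eval v (MvPolynomial.pderiv i P2)]

/-- The member of a net of symmetric matrices with coordinates `s`. -/
def pencil (A : Fin 3 → Matrix (Fin 5) (Fin 5) ℂ) (s : Fin 3 → ℂ) : Matrix (Fin 5) (Fin 5) ℂ :=
  ∑ k, s k • A k

/-- The quadratic form attached to a square matrix. -/
noncomputable def quadPoly {n : ℕ} (B : Matrix (Fin n) (Fin n) ℂ) : MvPolynomial (Fin n) ℂ :=
  ∑ i, ∑ j, C (B i j) * (X i * X j)

/-- The numerical criterion for a net of symmetric matrices, in terms of bases. -/
def MatStable (A : Fin 3 → Matrix (Fin 5) (Fin 5) ℂ) : Prop :=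
  ∀ s : Fin 3 → Fin 3 → ℂ, LinearIndependent ℂ s →
    ∀ v : Fin 5 → Fin 5 → ℂ, LinearIndependent ℂ v →
      ∀ (ρ : Fin 5 → ℤ) (w : Fin 3 → ℤ), IsNormalized ρ → ∑ k, w k < 0 →
        ∃ k i j, w k < ρ i + ρ j ∧ v i ⬝ᵥ (pencil A (s k)).mulVec (v j) ≠ 0

lemma exists_linearIndependent_extension {n : ℕ} {m : ℕ} (h : m ≤ n) (v : Fin m → Fin n → ℂ)
    (hv : LinearIndependent ℂ v) :
    ∃ w : Fin n → Fin n → ℂ, LinearIndependent ℂ w ∧ ∀ i, w (Fin.castLE h i) = v i := by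
  obtain ⟨k, rfl⟩ := Nat.exists_eq_add_of_le h
  suffices H : ∀ l ≤ k, ∃ w : Fin (m + l) → Fin (m + k) → ℂ, LinearIndependent ℂ w ∧
      ∀ i, w (Fin.castLE (Nat.le_add_right m l) i) = v i from H k le_rfl
  intro l
  induction l with
  | zero => exact fun _ => ⟨v, hv, fun i => rfl⟩
  | succ l ih =>
    intro hl
    obtain ⟨w, hw, hwv⟩ := ih (by omega)
    obtain ⟨x, hx⟩ := exists_linearIndependent_snoc_of_lt_finrank hw
      (by rw [Module.finrank_fintype_fun_eq_card, Fintype.card_fin]; omega)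
    refine ⟨_, hx, fun i => ?_⟩
    rw [← hwv i]
    exact Fin.snoc_castSucc (α := fun _ => Fin (m + k) → ℂ) x w (Fin.castLE _ i)

lemma pencil_isSymm {A : Fin 3 → Matrix (Fin 5) (Fin 5) ℂ} (hA : ∀ k, (A k).IsSymm)
    (s : Fin 3 → ℂ) : (pencil A s).IsSymm := by
  unfold pencil Matrix.IsSymm
  rw [Matrix.transpose_sum]
  exact Finset.sum_congr rfl fun k _ => by rw [Matrix.transpose_smul, hA k]

lemma dotProduct_mulVec_comm {n : ℕ} {B : Matrix (Fin n) (Fin n) ℂ} (hB : B.IsSymm)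
    (x y : Fin n → ℂ) : x ⬝ᵥ B.mulVec y = y ⬝ᵥ B.mulVec x := by
  rw [Matrix.dotProduct_mulVec, dotProduct_comm, ← Matrix.mulVec_transpose, hB]

/-- No base point is singular on a pencil contained in a stable net. -/
lemma MatStable.not_singular_pencil {A : Fin 3 → Matrix (Fin 5) (Fin 5) ℂ} (hst : MatStable A)
    (hA : ∀ k, (A k).IsSymm)
    (v : Fin 5 → ℂ) (hv : v ≠ 0) (s : Fin 2 → Fin 3 → ℂ)
    (hs : LinearIndependent ℂ s) (h0 : ∀ i, (pencil A (s i)).mulVec v = 0)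
    (hb : ∀ r, v ⬝ᵥ (pencil A r).mulVec v = 0) : False := by
  obtain ⟨w, hw, hwv⟩ := exists_linearIndependent_extension (n := 5) (m := 1) (by norm_num)
    (fun _ => v) (LinearIndependent.of_subsingleton 0 hv)
  obtain ⟨t, ht, hts⟩ := exists_linearIndependent_extension (n := 3) (m := 2) (by norm_num) s hs
  obtain ⟨k, i, j, hlt, hne⟩ := hst t ht w hw ![4,-1,-1,-1,-1] ![-2,-2,3]
    ⟨by decide, by decide, by decide⟩ (by decide)
  have key : ∀ (k : Fin 3) (i j : Fin 5), (![-2,-2,3] : Fin 3 → ℤ) k <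
      (![4,-1,-1,-1,-1] : Fin 5 → ℤ) i + (![4,-1,-1,-1,-1] : Fin 5 → ℤ) j →
      (k.1 < 2 ∧ (i = 0 ∨ j = 0)) ∨ (i = 0 ∧ j = 0) := by decide
  have hw0 : w 0 = v := hwv 0
  rcases key k i j hlt with ⟨hk, hij⟩ | ⟨rfl, rfl⟩
  · have hk' : t k = s ⟨k.1, hk⟩ := by rw [← hts]; rfl
    rw [hk'] at hne
    rcases hij with rfl | rfl
    · rw [dotProduct_mulVec_comm (pencil_isSymm hA _), hw0, h0, dotProduct_zero] at hne
      exact hne rfl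
    · rw [hw0, h0, dotProduct_zero] at hne
      exact hne rfl
  · rw [hw0] at hne
    exact hne (hb _)

/-- No pencil contained in a stable net vanishes on a hyperplane. -/
lemma MatStable.not_vanish_hyperplane {A : Fin 3 → Matrix (Fin 5) (Fin 5) ℂ} (hst : MatStable A)
    (v : Fin 4 → Fin 5 → ℂ) (hv : LinearIndependent ℂ v)
    (s : Fin 2 → Fin 3 → ℂ) (hs : LinearIndependent ℂ s)
    (h0 : ∀ k i j, v i ⬝ᵥ (pencil A (s k)).mulVec (v j) = 0) : False := by
  obtain ⟨w, hw, hwv⟩ := exists_linearIndependent_extension (n := 5) (by norm_num) v hv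
  obtain ⟨t, ht, hts⟩ := exists_linearIndependent_extension (n := 3) (m := 2) (by norm_num) s hs
  obtain ⟨k, i, j, hlt, hne⟩ := hst t ht w hw ![1,1,1,1,-4] ![-3,-3,2]
    ⟨by decide, by decide, by decide⟩ (by decide)
  have key : ∀ (k : Fin 3) (i j : Fin 5), (![-3,-3,2] : Fin 3 → ℤ) k <
      (![1,1,1,1,-4] : Fin 5 → ℤ) i + (![1,1,1,1,-4] : Fin 5 → ℤ) j →
      k.1 < 2 ∧ i.1 < 4 ∧ j.1 < 4 := by decide
  obtain ⟨hk, hi, hj⟩ := key k i j hlt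
  have hk' : t k = s ⟨k.1, hk⟩ := by rw [← hts]; rfl
  have hi' : w i = v ⟨i.1, hi⟩ := by rw [← hwv]; rfl
  have hj' : w j = v ⟨j.1, hj⟩ := by rw [← hwv]; rfl
  rw [hk', hi', hj'] at hne
  exact hne (h0 _ _ _)

/-- A stable net does not vanish on a plane. -/
lemma MatStable.not_vanish_plane {A : Fin 3 → Matrix (Fin 5) (Fin 5) ℂ} (hst : MatStable A)
    (v : Fin 3 → Fin 5 → ℂ) (hv : LinearIndependent ℂ v)
    (h0 : ∀ s i j, v i ⬝ᵥ (pencil A s).mulVec (v j) = 0) : False := by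
  obtain ⟨w, hw, hwv⟩ := exists_linearIndependent_extension (n := 5) (by norm_num) v hv
  obtain ⟨k, i, j, hlt, hne⟩ := hst _ (Pi.basisFun ℂ (Fin 3)).linearIndependent w hw
    ![2,2,2,-3,-3] ![-1,-1,-1] ⟨by decide, by decide, by decide⟩ (by decide)
  have key : ∀ (k : Fin 3) (i j : Fin 5), (![-1,-1,-1] : Fin 3 → ℤ) k <
      (![2,2,2,-3,-3] : Fin 5 → ℤ) i + (![2,2,2,-3,-3] : Fin 5 → ℤ) j →
      i.1 < 3 ∧ j.1 < 3 := by decide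
  obtain ⟨hi, hj⟩ := key k i j hlt
  have hi' : w i = v ⟨i.1, hi⟩ := by rw [← hwv]; rfl
  have hj' : w j = v ⟨j.1, hj⟩ := by rw [← hwv]; rfl
  rw [hi', hj'] at hne
  exact hne (h0 _ _ _)

/-- A stable net vanishing on a line has no member singular along that line. -/
lemma MatStable.not_singular_line {A : Fin 3 → Matrix (Fin 5) (Fin 5) ℂ} (hst : MatStable A)
    (hA : ∀ k, (A k).IsSymm)
    (v : Fin 2 → Fin 5 → ℂ) (hv : LinearIndependent ℂ v)
    (s : Fin 3 → ℂ) (hs : s ≠ 0) (h1 : ∀ i, (pencil A s).mulVec (v i) = 0)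
    (h0 : ∀ r i j, v i ⬝ᵥ (pencil A r).mulVec (v j) = 0) : False := by
  obtain ⟨w, hw, hwv⟩ := exists_linearIndependent_extension (n := 5) (by norm_num) v hv
  obtain ⟨t, ht, hts⟩ := exists_linearIndependent_extension (n := 3) (m := 1) (by norm_num)
    (fun _ => s) (LinearIndependent.of_subsingleton 0 hs)
  obtain ⟨k, i, j, hlt, hne⟩ := hst t ht w hw ![3,3,-2,-2,-2] ![-4,1,1]
    ⟨by decide, by decide, by decide⟩ (by decide)
  have key : ∀ (k : Fin 3) (i j : Fin 5), (![-4,1,1] : Fin 3 → ℤ) k <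
      (![3,3,-2,-2,-2] : Fin 5 → ℤ) i + (![3,3,-2,-2,-2] : Fin 5 → ℤ) j →
      (k = 0 ∧ (i.1 < 2 ∨ j.1 < 2)) ∨ (i.1 < 2 ∧ j.1 < 2) := by decide
  rcases key k i j hlt with ⟨rfl, hij⟩ | ⟨hi, hj⟩
  · have hk' : t 0 = s := hts 0
    rw [hk'] at hne
    rcases hij with hi | hj
    · have hi' : w i = v ⟨i.1, hi⟩ := by rw [← hwv]; rfl
      rw [dotProduct_mulVec_comm (pencil_isSymm hA _), hi', h1, dotProduct_zero] at hne
      exact hne rfl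
    · have hj' : w j = v ⟨j.1, hj⟩ := by rw [← hwv]; rfl
      rw [hj', h1, dotProduct_zero] at hne
      exact hne rfl
  · have hi' : w i = v ⟨i.1, hi⟩ := by rw [← hwv]; rfl
    have hj' : w j = v ⟨j.1, hj⟩ := by rw [← hwv]; rfl
    rw [hi', hj'] at hne
    exact hne (h0 _ _ _)

section quadPoly

variable {n : ℕ}

lemma quadPoly_smul (c : ℂ) (B : Matrix (Fin n) (Fin n) ℂ) :
    quadPoly (c • B) = c • quadPoly B := by
  simp only [quadPoly, Finset.smul_sum, Matrix.smul_apply, smul_eq_mul, C_mul, smul_eq_C_mul,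
    mul_assoc]

lemma quadPoly_add (B B' : Matrix (Fin n) (Fin n) ℂ) :
    quadPoly (B + B') = quadPoly B + quadPoly B' := by
  simp only [quadPoly, ← Finset.sum_add_distrib, Matrix.add_apply, C_add, add_mul]

/-- `quadPoly` as a linear map. -/
noncomputable def quadPolyLin (n : ℕ) : Matrix (Fin n) (Fin n) ℂ →ₗ[ℂ] MvPolynomial (Fin n) ℂ where
  toFun := quadPoly
  map_add' := quadPoly_add
  map_smul' := quadPoly_smul

lemma quadPoly_pencil (A : Fin 3 → Matrix (Fin 5) (Fin 5) ℂ) (s : Fin 3 → ℂ) :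
    quadPoly (pencil A s) = ∑ k, s k • quadPoly (A k) := by
  have := map_sum (quadPolyLin 5) (fun k => s k • A k) Finset.univ
  simp only [map_smul] at this
  exact this

lemma quadPoly_isHomogeneous (B : Matrix (Fin n) (Fin n) ℂ) : (quadPoly B).IsHomogeneous 2 := by
  refine IsHomogeneous.sum _ _ _ fun i _ => IsHomogeneous.sum _ _ _ fun j _ => ?_
  have := ((isHomogeneous_C (Fin n) (B i j)).mul ((isHomogeneous_X ℂ i).mul (isHomogeneous_X ℂ j)))
  simpa using this

lemma aeval_quadPoly {R : Type*} [CommRing R] [Algebra ℂ R] (B : Matrix (Fin n) (Fin n) ℂ)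
    (x : Fin n → R) :
    aeval x (quadPoly B) = ∑ i, ∑ j, algebraMap ℂ R (B i j) * (x i * x j) := by
  simp [quadPoly]

lemma eval_quadPoly (B : Matrix (Fin n) (Fin n) ℂ) (x : Fin n → ℂ) :
    eval x (quadPoly B) = x ⬝ᵥ B.mulVec x := by
  simp only [quadPoly, map_sum, map_mul, eval_C, eval_X, dotProduct, Matrix.mulVec,
    Finset.mul_sum]
  exact Finset.sum_congr rfl fun i _ => Finset.sum_congr rfl fun j _ => by ring

lemma coeff_quadPoly (B : Matrix (Fin n) (Fin n) ℂ) (m : Fin n →₀ ℕ) :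
    coeff m (quadPoly B) =
      ∑ i, ∑ j, if Finsupp.single i 1 + Finsupp.single j 1 = m then B i j else 0 := by
  simp only [quadPoly, coeff_sum]
  refine Finset.sum_congr rfl fun i _ => Finset.sum_congr rfl fun j _ => ?_
  rw [X, X, monomial_mul, C_mul_monomial, coeff_monomial]
  simp

lemma exists_of_coeff_quadPoly_ne_zero {B : Matrix (Fin n) (Fin n) ℂ} {m : Fin n →₀ ℕ}
    (h : coeff m (quadPoly B) ≠ 0) :
    ∃ i j, m = Finsupp.single i 1 + Finsupp.single j 1 ∧ B i j ≠ 0 := by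
  rw [coeff_quadPoly] at h
  obtain ⟨i, -, hi⟩ := Finset.exists_ne_zero_of_sum_ne_zero h
  obtain ⟨j, -, hj⟩ := Finset.exists_ne_zero_of_sum_ne_zero hi
  split_ifs at hj with hm
  · exact ⟨i, j, hm.symm, hj⟩
  · exact absurd rfl hj

lemma pair_eq_pair_iff (i j k l : Fin n) :
    (Finsupp.single i 1 + Finsupp.single j 1 : Fin n →₀ ℕ) =
      Finsupp.single k 1 + Finsupp.single l 1 ↔ (i = k ∧ j = l) ∨ (i = l ∧ j = k) := by
  rw [← Multiset.toFinsupp_singleton, ← Multiset.toFinsupp_singleton,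
    ← Multiset.toFinsupp_singleton, ← Multiset.toFinsupp_singleton, ← map_add, ← map_add,
    EmbeddingLike.apply_eq_iff_eq]
  simp only [Multiset.singleton_add]
  rw [← Sym2.eq_iff, Sym2.eq_iff]
  exact Multiset.cons_eq_cons.trans (by
    constructor
    · rintro (⟨rfl, h⟩ | ⟨h, c, h1, h2⟩)
      · exact Or.inl ⟨rfl, by simpa using h⟩
      · have hc : c = 0 := by
          have := congrArg Multiset.card h1
          simpa using this.symm
        subst hc
        exact Or.inr ⟨by simpa using h2.symm, by simpa using h1⟩
    · rintro (⟨rfl, rfl⟩ | ⟨rfl, rfl⟩)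
      · exact Or.inl ⟨rfl, rfl⟩
      · by_cases h : i = j
        · subst h; exact Or.inl ⟨rfl, rfl⟩
        · exact Or.inr ⟨h, 0, rfl, rfl⟩)

lemma coeff_quadPoly_of_isSymm {B : Matrix (Fin n) (Fin n) ℂ} (hB : B.IsSymm) (i j : Fin n) :
    coeff (Finsupp.single i 1 + Finsupp.single j 1) (quadPoly B) =
      if i = j then B i i else 2 * B i j := by
  rw [coeff_quadPoly]
  simp only [pair_eq_pair_iff]
  split_ifs with h
  · subst h
    simp only [or_self, ite_and]
    simp
  · have : ∀ k l, (if (k = i ∧ l = j) ∨ (k = j ∧ l = i) then B k l else 0) =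
        (if k = i then if l = j then B k l else 0 else 0) +
        (if k = j then if l = i then B k l else 0 else 0) := by
      intro k l
      by_cases h1 : k = i <;> by_cases h2 : l = j <;> by_cases h3 : k = j <;> by_cases h4 : l = i
      all_goals simp_all
    simp only [this, Finset.sum_add_distrib]
    simp [hB.apply i j]
    ring

lemma quadPoly_injective_of_isSymm {B : Matrix (Fin n) (Fin n) ℂ} (hB : B.IsSymm)
    (h : quadPoly B = 0) : B = 0 := by
  ext i j
  have := coeff_quadPoly_of_isSymm hB i j
  rw [h, coeff_zero] at this
  split_ifs at this with hij
  · subst hij; exact this.symm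
  · simpa using this.symm

end quadPoly

lemma quadMatrix_isSymm (Q : Quin) : (quadMatrix Q).IsSymm := by
  ext i j
  simp only [quadMatrix, Matrix.transpose_apply, Matrix.of_apply]
  by_cases h : i = j
  · subst h; rfl
  · rw [if_neg h, if_neg (Ne.symm h), add_comm]

lemma quadPoly_quadMatrix {Q : Quin} (hQ : Q.IsHomogeneous 2) : quadPoly (quadMatrix Q) = Q := by
  ext m
  by_cases hm : m.degree = 2
  · have hcard : Multiset.card (Finsupp.toMultiset m) = 2 := by
      rw [Finsupp.card_toMultiset]; exact hm
    obtain ⟨i, j, hij⟩ := Multiset.card_eq_two.1 hcard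
    have : m = Finsupp.single i 1 + Finsupp.single j 1 := by
      rw [← Finsupp.toMultiset_toFinsupp m, hij, ← Multiset.toFinsupp_singleton,
        ← Multiset.toFinsupp_singleton, ← map_add]
      rfl
    subst this
    rw [coeff_quadPoly_of_isSymm (quadMatrix_isSymm Q)]
    split_ifs with h
    · subst h
      simp only [quadMatrix, Matrix.of_apply, if_true]
      rw [← Finsupp.single_add]
    · simp [quadMatrix, h]
  · rw [(quadPoly_isHomogeneous _).coeff_eq_zero hm, hQ.coeff_eq_zero hm]

lemma substMap_quadPoly (g B : Matrix (Fin 5) (Fin 5) ℂ) :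
    substMap g (quadPoly B) = quadPoly (g.transpose * B * g) := by
  apply MvPolynomial.funext
  intro x
  have h1 : eval x (substMap g (quadPoly B)) = eval (g.mulVec x) (quadPoly B) := by
    rw [substMap, AlgHom.toLinearMap_apply, aeval_quadPoly, eval_quadPoly]
    have hx : ∀ i, eval x (∑ j, C (g i j) * X j) = g.mulVec x i := fun i => by
      simp [Matrix.mulVec, dotProduct]
    simp only [map_sum (eval x) _ Finset.univ, map_mul, eval_C, algebraMap_eq] at hx ⊢
    simp only [hx, dotProduct, Matrix.mulVec.eq_1 B, Finset.mul_sum]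
    exact Finset.sum_congr rfl fun i _ => Finset.sum_congr rfl fun j _ => by ring
  rw [h1, eval_quadPoly, eval_quadPoly, ← Matrix.mulVec_mulVec, ← Matrix.mulVec_mulVec,
    Matrix.dotProduct_mulVec x, Matrix.vecMul_transpose]

lemma wt_pair (ρ : Fin 5 → ℤ) (i j : Fin 5) :
    wt ρ (Finsupp.single i 1 + Finsupp.single j 1) = ρ i + ρ j := by
  simp [wt, add_mul, Finset.sum_add_distrib, Finsupp.single_apply]

lemma matStable_of_semistable {Λ : Submodule ℂ Quin} (hss : Semistable Λ)
    (A : Fin 3 → Matrix (Fin 5) (Fin 5) ℂ)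
    (hspan : Submodule.span ℂ (Set.range fun k => quadPoly (A k)) = Λ) : MatStable A := by
  intro s hs v hv ρ w hρ hw
  by_contra! hcon
  let g : Matrix (Fin 5) (Fin 5) ℂ := Matrix.of fun i j => v j i
  have hg : IsUnit g := by
    rw [← Matrix.linearIndependent_cols_iff_isUnit]
    exact hv
  obtain ⟨m1, m2, m3, -, -, -, -, -, -, hwt, hbij⟩ := hss hg.unit ρ hρ
  let m : Fin 3 → Fin 5 →₀ ℕ := ![m1, m2, m3]
  let F : Fin 3 → Quin := fun k => quadPoly (g.transpose * pencil A (s k) * g)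
  have hspan' : Submodule.span ℂ (Set.range F) = Submodule.map (substMap g) Λ := by
    have h1 : Submodule.span ℂ (Set.range fun k => quadPoly (pencil A (s k))) = Λ := by
      apply le_antisymm
      · rw [Submodule.span_le]
        rintro _ ⟨k, rfl⟩
        simp only [quadPoly_pencil, ← hspan]
        exact Submodule.sum_mem _ fun l _ => Submodule.smul_mem _ _ (Submodule.subset_span ⟨l, rfl⟩)
      · rw [← hspan, Submodule.span_le]
        rintro _ ⟨k, rfl⟩
        have htop : Submodule.span ℂ (Set.range s) = ⊤ :=
          hs.span_eq_top_of_card_eq_finrank (by simp)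
        have hmem : (Pi.single k 1 : Fin 3 → ℂ) ∈ Submodule.span ℂ (Set.range s) := by
          rw [htop]; trivial
        obtain ⟨c, hc⟩ := (Submodule.mem_span_range_iff_exists_fun ℂ).1 hmem
        have : quadPoly (A k) = ∑ l, c l • quadPoly (pencil A (s l)) := by
          simp only [quadPoly_pencil, Finset.smul_sum]
          rw [Finset.sum_comm]
          simp only [smul_smul, ← Finset.sum_smul]
          have h2 : ∀ j, ∑ l, c l * s l j = (Pi.single k 1 : Fin 3 → ℂ) j := by
            intro j; rw [← hc]; simp
          simp only [h2]
          simp [Pi.single_apply]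
        change quadPoly (A k) ∈ _
        rw [this]
        exact Submodule.sum_mem _ fun l _ => Submodule.smul_mem _ _ (Submodule.subset_span ⟨l, rfl⟩)
    rw [← h1, Submodule.map_span, ← Set.range_comp]
    congr 2
    funext k
    exact (substMap_quadPoly _ _).symm
  let D : Matrix (Fin 3) (Fin 3) ℂ := Matrix.of fun k l => coeff (m l) (F k)
  have hD : IsUnit D := by
    rw [← Matrix.linearIndependent_rows_iff_isUnit]
    apply linearIndependent_of_top_le_span_of_card_eq_finrank
    · intro y _
      obtain ⟨⟨q, hq⟩, hqy⟩ := hbij.2 y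
      have hq' : q ∈ Submodule.span ℂ (Set.range F) := by rw [hspan']; exact hq
      obtain ⟨c, rfl⟩ := (Submodule.mem_span_range_iff_exists_fun ℂ).1 hq'
      rw [Submodule.mem_span_range_iff_exists_fun]
      refine ⟨c, ?_⟩
      rw [← hqy]
      funext l
      fin_cases l <;> simp [D, m, coeff_sum, Matrix.row]
    · simp
  have hdet : D.det ≠ 0 := by
    rw [Matrix.isUnit_iff_isUnit_det] at hD
    exact hD.ne_zero
  rw [Matrix.det_apply] at hdet
  obtain ⟨σ, -, hσ⟩ := Finset.exists_ne_zero_of_sum_ne_zero hdet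
  have hprod : ∏ i, D (σ i) i ≠ 0 := fun h => hσ (by rw [h, smul_zero])
  have hle : ∀ l, wt ρ (m l) ≤ w (σ l) := by
    intro l
    have hl : coeff (m l) (F (σ l)) ≠ 0 := Finset.prod_ne_zero_iff.1 hprod l (Finset.mem_univ _)
    obtain ⟨i, j, hij, hne⟩ := exists_of_coeff_quadPoly_ne_zero hl
    rw [hij, wt_pair]
    by_contra! hlt
    apply hne
    have := hcon (σ l) i j hlt
    rw [← this, Matrix.mul_assoc]
    rfl
  have : ∑ l, wt ρ (m l) ≤ ∑ k, w k := by
    rw [← Equiv.sum_comp σ w]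
    exact Finset.sum_le_sum fun l _ => hle l
  simp only [Fin.sum_univ_three, m] at this
  simp at this
  simp only [Fin.sum_univ_three] at hw
  omega

lemma exists_eq_add_sum_X_sub_C_mul {n : ℕ} (p : MvPolynomial (Fin n) ℂ) (t : Fin n → ℂ) :
    ∃ h : Fin n → MvPolynomial (Fin n) ℂ, p = C (eval t p) + ∑ i, (X i - C (t i)) * h i := by
  induction p using MvPolynomial.induction_on with
  | C a => exact ⟨0, by simp⟩
  | add p q hp hq =>
    obtain ⟨h, hp⟩ := hp
    obtain ⟨k, hq⟩ := hq
    refine ⟨h + k, ?_⟩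
    conv_lhs => rw [hp, hq]
    simp only [Pi.add_apply, mul_add, Finset.sum_add_distrib, map_add]
    ring
  | mul_X p i hp =>
    obtain ⟨h, hp⟩ := hp
    refine ⟨fun j => h j * X i + if j = i then C (eval t p) else 0, ?_⟩
    conv_lhs => rw [hp]
    simp only [mul_add, Finset.sum_add_distrib, map_mul, eval_X, mul_ite, mul_zero,
      Finset.sum_ite_eq', Finset.mem_univ, if_true, add_mul, Finset.sum_mul, mul_assoc]
    ring

lemma exists_binary_zero (α β γ : ℂ) :
    ∃ x y : ℂ, (x ≠ 0 ∨ y ≠ 0) ∧ α * x ^ 2 + 2 * β * (x * y) + γ * y ^ 2 = 0 := by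
  by_cases hα : α = 0
  · exact ⟨1, 0, Or.inl one_ne_zero, by simp [hα]⟩
  · obtain ⟨d, hd⟩ := IsAlgClosed.exists_pow_nat_eq (β ^ 2 - α * γ) (n := 2) (by norm_num)
    refine ⟨(d - β) / α, 1, Or.inr one_ne_zero, ?_⟩
    field_simp
    linear_combination hd

lemma quadForm_comb {n : ℕ} {B : Matrix (Fin n) (Fin n) ℂ} (hB : B.IsSymm) (x y : ℂ)
    (v w : Fin n → ℂ) :
    (x • v + y • w) ⬝ᵥ B.mulVec (x • v + y • w) =
      v ⬝ᵥ B.mulVec v * x ^ 2 + 2 * (v ⬝ᵥ B.mulVec w) * (x * y) + w ⬝ᵥ B.mulVec w * y ^ 2 := by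
  simp only [Matrix.mulVec_add, Matrix.mulVec_smul, dotProduct_add, add_dotProduct,
    smul_dotProduct, dotProduct_smul, smul_eq_mul]
  rw [dotProduct_mulVec_comm hB w v]
  ring

lemma exists_isotropic_comb {n : ℕ} {B : Matrix (Fin n) (Fin n) ℂ} (hB : B.IsSymm)
    (v w : Fin n → ℂ) : ∃ x y : ℂ, (x ≠ 0 ∨ y ≠ 0) ∧
      (x • v + y • w) ⬝ᵥ B.mulVec (x • v + y • w) = 0 := by
  obtain ⟨x, y, h, h0⟩ := exists_binary_zero (v ⬝ᵥ B.mulVec v) (v ⬝ᵥ B.mulVec w) (w ⬝ᵥ B.mulVec w)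
  exact ⟨x, y, h, by rw [quadForm_comb hB, h0]⟩

lemma exists_common_zero_of_singular {B D : Matrix (Fin 3) (Fin 3) ℂ} (hB : B.IsSymm)
    (hD : D.IsSymm) (w : Fin 3 → ℂ) (hw : w ≠ 0) (hBw : B.mulVec w = 0) :
    ∃ u : Fin 3 → ℂ, u ≠ 0 ∧ u ⬝ᵥ B.mulVec u = 0 ∧ u ⬝ᵥ D.mulVec u = 0 := by
  obtain ⟨b, hb, hb0⟩ := exists_linearIndependent_extension (n := 3) (m := 1) (by norm_num)
    (fun _ => w) (LinearIndependent.of_subsingleton 0 hw)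
  have hb0 : b 0 = w := hb0 0
  rw [Fintype.linearIndependent_iff] at hb
  obtain ⟨x, y, hxy, h1⟩ := exists_isotropic_comb hB (b 1) (b 2)
  obtain ⟨z, r, hzr, h2⟩ := exists_isotropic_comb hD w (x • b 1 + y • b 2)
  refine ⟨_, ?_, ?_, h2⟩
  · intro h
    have := hb ![z, r * x, r * y] (by
      rw [Fin.sum_univ_three, hb0]
      simpa [smul_smul, add_assoc] using h)
    have h0 := this 0
    have h1 := this 1
    have h2 := this 2
    simp at h0 h1 h2
    grind
  · rw [quadForm_comb hB, h1, hBw, dotProduct_mulVec_comm hB, hBw]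
    simp

/-- Two conics meet. -/
lemma exists_common_zero {B D : Matrix (Fin 3) (Fin 3) ℂ} (hB : B.IsSymm) (hD : D.IsSymm) :
    ∃ u : Fin 3 → ℂ, u ≠ 0 ∧ u ⬝ᵥ B.mulVec u = 0 ∧ u ⬝ᵥ D.mulVec u = 0 := by
  by_cases hdet : D.det = 0
  · obtain ⟨w, hw, hDw⟩ := Matrix.exists_mulVec_eq_zero_iff.2 hdet
    obtain ⟨u, hu, h1, h2⟩ := exists_common_zero_of_singular hD hB w hw hDw
    exact ⟨u, hu, h2, h1⟩
  · obtain ⟨μ, hμ⟩ := Module.End.exists_eigenvalue (Matrix.mulVecLin (D⁻¹ * B))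
    obtain ⟨w, hw, hw0⟩ := hμ.exists_hasEigenvector
    have hw1 : (D⁻¹ * B).mulVec w = μ • w := by
      simpa using Module.End.mem_eigenspace_iff.1 hw
    have hw2 : B.mulVec w = μ • D.mulVec w := by
      rw [← Matrix.mulVec_smul, ← hw1, Matrix.mulVec_mulVec, Matrix.mul_nonsing_inv_cancel_left]
      exact Ne.isUnit hdet
    have hBD : (B - μ • D).IsSymm := hB.sub (hD.smul μ)
    obtain ⟨u, hu, h1, h2⟩ := exists_common_zero_of_singular hBD hD w hw0 (by
      rw [Matrix.sub_mulVec, Matrix.smul_mulVec, hw2, sub_self])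
    refine ⟨u, hu, ?_, h2⟩
    rw [Matrix.sub_mulVec, Matrix.smul_mulVec, dotProduct_sub, dotProduct_smul, h2] at h1
    simpa using h1

/-- A pencil of binary quadratic forms whose discriminant is a square has a common zero. -/
lemma exists_common_zero_of_discr_eq_sq (α β γ ℓ : (Fin 3 → ℂ) →ₗ[ℂ] ℂ) (c : ℂ) (t : Fin 3 → ℂ)
    (ht : t ≠ 0) (hα : α t = 0) (hβ : β t = 0) (hγ : γ t = 0)
    (h : ∀ s, α s * γ s - β s ^ 2 = c * ℓ s ^ 2) :
    ∃ x y : ℂ, (x ≠ 0 ∨ y ≠ 0) ∧ ∀ s, α s * x ^ 2 + 2 * β s * (x * y) + γ s * y ^ 2 = 0 := by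
  obtain ⟨s₁, hts, hs₁⟩ : ∃ s₁, LinearIndependent ℂ ![t, s₁] ∧ c * ℓ s₁ = 0 := by
    have hlt : (c • ℓ) t = 0 := by
      have := h t
      rw [hα, hβ] at this
      have : c * ℓ t ^ 2 = 0 := by linear_combination -this
      rcases mul_eq_zero.1 this with h | h
      · simp [h]
      · simp [pow_eq_zero_iff two_ne_zero |>.1 h]
    have hrank := LinearMap.finrank_range_add_finrank_ker (c • ℓ)
    have hr1 : Module.finrank ℂ (LinearMap.range (c • ℓ)) ≤ 1 := by
      simpa using Submodule.finrank_le (LinearMap.range (c • ℓ))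
    rw [Module.finrank_fintype_fun_eq_card, Fintype.card_fin] at hrank
    have : ¬ LinearMap.ker (c • ℓ) ≤ Submodule.span ℂ {t} := by
      intro hle
      have := Submodule.finrank_mono hle
      rw [finrank_span_singleton ht] at this
      omega
    obtain ⟨s₁, hs₁, hnot⟩ := SetLike.not_le_iff_exists.1 this
    refine ⟨s₁, ?_, by simpa using hs₁⟩
    rw [LinearIndependent.pair_iff' ht]
    intro a ha
    exact hnot (Submodule.mem_span_singleton.2 ⟨a, ha⟩)
  obtain ⟨b, hb, hbe⟩ := exists_linearIndependent_extension (n := 3) (m := 2) (by norm_num) _ hts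
  have hb0 : b 0 = t := hbe 0
  have hb1 : b 1 = s₁ := hbe 1
  have hspan : ∀ s, ∃ a : Fin 3 → ℂ, s = a 0 • t + a 1 • s₁ + a 2 • b 2 := by
    intro s
    have htop := hb.span_eq_top_of_card_eq_finrank (by simp)
    obtain ⟨a, ha⟩ := (Submodule.mem_span_range_iff_exists_fun ℂ).1
      (htop ▸ Submodule.mem_top : s ∈ Submodule.span ℂ (Set.range b))
    exact ⟨a, by rw [← ha, Fin.sum_univ_three, hb0, hb1]⟩
  have h1 : α s₁ * γ s₁ - β s₁ ^ 2 = 0 := by rw [h]; linear_combination ℓ s₁ * hs₁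
  have h2 : α s₁ * γ (b 2) + γ s₁ * α (b 2) - 2 * β s₁ * β (b 2) = 0 := by
    have e1 := h (s₁ + b 2)
    have e2 := h (b 2)
    simp only [map_add] at e1
    linear_combination e1 - e2 - h1 + (2 * ℓ (b 2) + ℓ s₁) * hs₁
  suffices H : ∃ x y : ℂ, (x ≠ 0 ∨ y ≠ 0) ∧
      α s₁ * x ^ 2 + 2 * β s₁ * (x * y) + γ s₁ * y ^ 2 = 0 ∧
      α (b 2) * x ^ 2 + 2 * β (b 2) * (x * y) + γ (b 2) * y ^ 2 = 0 by
    obtain ⟨x, y, hxy, e1, e2⟩ := H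
    refine ⟨x, y, hxy, fun s => ?_⟩
    obtain ⟨a, rfl⟩ := hspan s
    simp only [map_add, map_smul, smul_eq_mul, hα, hβ, hγ]
    linear_combination a 1 * e1 + a 2 * e2
  by_cases hab : α s₁ = 0 ∧ β s₁ = 0
  · obtain ⟨ha, hb'⟩ := hab
    by_cases hc : γ s₁ = 0
    · obtain ⟨x, y, hxy, e⟩ := exists_binary_zero (α (b 2)) (β (b 2)) (γ (b 2))
      exact ⟨x, y, hxy, by simp [ha, hb', hc], e⟩
    · refine ⟨1, 0, Or.inl one_ne_zero, by simp [ha], ?_⟩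
      rw [ha, hb'] at h2
      have : γ s₁ * α (b 2) = 0 := by linear_combination h2
      simp [(mul_eq_zero.1 this).resolve_left hc]
  · refine ⟨β s₁, -α s₁, ?_, ?_, ?_⟩
    · by_contra! hcon
      exact hab ⟨by simpa using hcon.2, hcon.1⟩
    · linear_combination α s₁ * h1
    · linear_combination α s₁ * h2 - α (b 2) * h1

/-- Expansion of the determinant of a pencil at a member with known kernel. -/
lemma exists_det_expansion {d e : ℕ} {B : Matrix (Fin (d + e)) (Fin (d + e)) ℂ} (hB : B.IsSymm)
    (w : Fin (d + e) → Fin (d + e) → ℂ) (hw : LinearIndependent ℂ w)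
    (hk : ∀ i : Fin d, B.mulVec (w (Fin.castAdd e i)) = 0)
    (hker : ∀ x, B.mulVec x = 0 → x ∈ Submodule.span ℂ (Set.range fun i => w (Fin.castAdd e i))) :
    ∃ κ : ℂ, κ ≠ 0 ∧ ∀ S : Matrix (Fin (d + e)) (Fin (d + e)) ℂ, ∃ G : ℂ → ℂ, Continuous G ∧
      G 0 = κ * (Matrix.of fun i j : Fin d =>
        w (Fin.castAdd e i) ⬝ᵥ S.mulVec (w (Fin.castAdd e j))).det ∧
      ∀ ε, (B + ε • S).det = ε ^ d * G ε := by
  let W : Matrix (Fin (d + e)) (Fin (d + e)) ℂ := Matrix.of w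
  have hW : W.det ≠ 0 := by
    have : IsUnit W := Matrix.linearIndependent_rows_iff_isUnit.1 hw
    exact ((Matrix.isUnit_iff_isUnit_det _).1 this).ne_zero
  have hk' : ∀ (i : Fin d) x, w (Fin.castAdd e i) ⬝ᵥ B.mulVec x = 0 := fun i x => by
    rw [dotProduct_mulVec_comm hB, hk, dotProduct_zero]
  let B₂ : Matrix (Fin e) (Fin e) ℂ :=
    Matrix.of fun i j => w (Fin.natAdd d i) ⬝ᵥ B.mulVec (w (Fin.natAdd d j))
  have hB₂ : B₂.det ≠ 0 := by
    intro h0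
    obtain ⟨c, hc, hc0⟩ := Matrix.exists_mulVec_eq_zero_iff.2 h0
    let x := ∑ j, c j • w (Fin.natAdd d j)
    have hx : B.mulVec x = 0 := by
      have : W.mulVec (B.mulVec x) = 0 := by
        funext i
        refine Fin.addCases (fun i => hk' i x) (fun i => ?_) i
        have h0 := congrFun hc0 i
        change w (Fin.natAdd d i) ⬝ᵥ B.mulVec x = 0
        simp only [x, Matrix.mulVec_sum, Matrix.mulVec_smul, dotProduct_sum, dotProduct_smul,
          smul_eq_mul]
        simpa [B₂, Matrix.mulVec, dotProduct, mul_comm] using h0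
      exact Matrix.eq_zero_of_mulVec_eq_zero hW this
    obtain ⟨a, ha⟩ := (Submodule.mem_span_range_iff_exists_fun ℂ).1 (hker x hx)
    rw [Fintype.linearIndependent_iff] at hw
    have := hw (Fin.addCases a (fun j => -c j)) (by
      rw [Fin.sum_univ_add]
      simp [ha, x])
    exact hc (funext fun j => by simpa using this (Fin.natAdd d j))
  refine ⟨B₂.det / W.det ^ 2, div_ne_zero hB₂ (pow_ne_zero 2 hW), fun S => ?_⟩
  let b : Fin (d + e) → Fin (d + e) → ℂ := fun i j => w i ⬝ᵥ S.mulVec (w j)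
  let M : ℂ → Matrix (Fin d ⊕ Fin e) (Fin d ⊕ Fin e) ℂ := fun ε => Matrix.fromBlocks
    (Matrix.of fun i j => b (Fin.castAdd e i) (Fin.castAdd e j))
    (Matrix.of fun i j => b (Fin.castAdd e i) (Fin.natAdd d j))
    (ε • Matrix.of fun i j => b (Fin.natAdd d i) (Fin.castAdd e j))
    (B₂ + ε • Matrix.of fun i j => b (Fin.natAdd d i) (Fin.natAdd d j))
  refine ⟨fun ε => (M ε).det / W.det ^ 2, ?_, ?_, fun ε => ?_⟩
  · refine Continuous.div_const (Continuous.matrix_det ?_) _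
    refine Continuous.matrix_fromBlocks ?_ ?_ ?_ ?_ <;> fun_prop
  · simp only [M, zero_smul, add_zero, Matrix.det_fromBlocks_zero₂₁]
    ring
  · have h1 : (W * (B + ε • S) * W.transpose).submatrix finSumFinEquiv finSumFinEquiv =
        Matrix.fromBlocks (ε • (1 : Matrix (Fin d) (Fin d) ℂ)) 0 0 1 * M ε := by
      have entry : ∀ i j,
          (W * (B + ε • S) * W.transpose) i j = w i ⬝ᵥ B.mulVec (w j) + ε * b i j := by
        intro i j
        have : (W * (B + ε • S) * W.transpose) i j = w i ⬝ᵥ (B + ε • S).mulVec (w j) := by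
          rw [Matrix.mul_assoc]; rfl
        rw [this, Matrix.add_mulVec, dotProduct_add, Matrix.smul_mulVec, dotProduct_smul,
          smul_eq_mul]
      rw [Matrix.fromBlocks_multiply]
      ext (i | i) (j | j)
      · simp [entry, hk]
      · simp [entry, hk']
      · simp [entry, hk]
      · simp [entry, B₂]
    have h2 := congrArg Matrix.det h1
    rw [Matrix.det_submatrix_equiv_self, Matrix.det_mul, Matrix.det_mul, Matrix.det_transpose,
      Matrix.det_mul, Matrix.det_fromBlocks_zero₂₁, Matrix.det_smul, Matrix.det_one,
      Matrix.det_one, Fintype.card_fin] at h2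
    rw [mul_div_assoc', eq_div_iff (pow_ne_zero 2 hW)]
    linear_combination h2

lemma exists_kernel_expansion {n : ℕ} {B : Matrix (Fin n) (Fin n) ℂ} (hB : B.IsSymm) :
    ∃ (d : ℕ) (v : Fin d → Fin n → ℂ), LinearIndependent ℂ v ∧ (∀ i, B.mulVec (v i) = 0) ∧
      (B.det = 0 → 0 < d) ∧ ∃ κ : ℂ, κ ≠ 0 ∧ ∀ S : Matrix (Fin n) (Fin n) ℂ,
        ∃ G : ℂ → ℂ, Continuous G ∧
          G 0 = κ * (Matrix.of fun i j : Fin d => v i ⬝ᵥ S.mulVec (v j)).det ∧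
          ∀ ε, (B + ε • S).det = ε ^ d * G ε := by
  let K := LinearMap.ker B.mulVecLin
  let b := Module.finBasis ℂ K
  set d := Module.finrank ℂ K with hd
  let v : Fin d → Fin n → ℂ := fun i => (b i : Fin n → ℂ)
  have hv : LinearIndependent ℂ v := b.linearIndependent.map' K.subtype (Submodule.ker_subtype K)
  have hk : ∀ i, B.mulVec (v i) = 0 := fun i => (b i).2
  have hker : ∀ x, B.mulVec x = 0 → x ∈ Submodule.span ℂ (Set.range v) := by
    intro x hx
    have : (⟨x, hx⟩ : K) ∈ Submodule.span ℂ (Set.range b) := by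
      rw [b.span_eq]; trivial
    have := Submodule.mem_map_of_mem (f := K.subtype) this
    rw [Submodule.map_span, ← Set.range_comp] at this
    exact this
  have hdn : d ≤ n := by
    simpa using K.finrank_le
  refine ⟨d, v, hv, hk, fun h0 => ?_, ?_⟩
  · obtain ⟨x, hx, hx0⟩ := Matrix.exists_mulVec_eq_zero_iff.2 h0
    rw [hd, Module.finrank_pos_iff_exists_ne_zero]
    exact ⟨⟨x, hx0⟩, fun h => hx (congrArg Subtype.val h)⟩
  · clear_value d
    obtain ⟨e, rfl⟩ := Nat.exists_eq_add_of_le hdn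
    obtain ⟨w, hw, hwv⟩ := exists_linearIndependent_extension hdn v hv
    have hwv' : ∀ i, w (Fin.castAdd e i) = v i := hwv
    have := exists_det_expansion hB w hw (fun i => by rw [hwv', hk])
      (fun x hx => by simpa only [hwv'] using hker x hx)
    simpa only [hwv'] using this

/-- A multiple zero of the discriminant gives a singular base point of the net. -/
lemma exists_singular_base_point {A : Fin 3 → Matrix (Fin 5) (Fin 5) ℂ} (hA : ∀ k, (A k).IsSymm)
    {p q : MvPolynomial (Fin 3) ℂ} (hdet : ∀ s, (pencil A s).det = eval s p ^ 2 * eval s q)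
    {t : Fin 3 → ℂ} (ht : t ≠ 0) (hpt : eval t p = 0) :
    ∃ v : Fin 5 → ℂ, v ≠ 0 ∧ (pencil A t).mulVec v = 0 ∧
      ∀ r, v ⬝ᵥ (pencil A r).mulVec v = 0 := by
  obtain ⟨d, v, hv, hk, hd, κ, hκ, hexp⟩ := exists_kernel_expansion (pencil_isSymm hA t)
  have hd := hd (by rw [hdet, hpt]; ring)
  obtain ⟨h, hp⟩ := exists_eq_add_sum_X_sub_C_mul p t
  have hadd : ∀ (ε : ℂ) (s : Fin 3 → ℂ), pencil A (t + ε • s) = pencil A t + ε • pencil A s := by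
    intro ε s
    simp only [pencil, Finset.smul_sum, ← Finset.sum_add_distrib, Pi.add_apply, Pi.smul_apply,
      add_smul, smul_assoc]
  have hlin : ∀ (x y : Fin 5 → ℂ) (s : Fin 3 → ℂ), x ⬝ᵥ (pencil A s).mulVec y =
      ∑ k, s k * (x ⬝ᵥ (A k).mulVec y) := by
    intro x y s
    simp [pencil, Matrix.sum_mulVec, Matrix.smul_mulVec, dotProduct_sum]
  have hpe : ∀ (ε : ℂ) (s : Fin 3 → ℂ), eval (t + ε • s) p =
      ε * ∑ i, s i * eval (t + ε • s) (h i) := by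
    intro ε s
    conv_lhs => rw [hp]
    simp [hpt, Finset.mul_sum, mul_assoc]
  have hkey : ∀ s : Fin 3 → ℂ, ∃ G : ℂ → ℂ, Continuous G ∧
      G 0 = κ * (Matrix.of fun i j : Fin d => v i ⬝ᵥ (pencil A s).mulVec (v j)).det ∧
      ∀ ε, ε ^ d * G ε = ε ^ 2 * ((∑ i, s i * eval (t + ε • s) (h i)) ^ 2 *
        eval (t + ε • s) q) := by
    intro s
    obtain ⟨G, hG, hG0, hGe⟩ := hexp (pencil A s)
    refine ⟨G, hG, hG0, fun ε => ?_⟩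
    rw [← hGe, ← hadd, hdet, hpe]
    ring
  have hcont : ∀ (f : MvPolynomial (Fin 3) ℂ) (s : Fin 3 → ℂ),
      Continuous fun ε : ℂ => eval (t + ε • s) f := by
    intro f s
    exact (MvPolynomial.continuous_eval f).comp (by fun_prop)
  have hdense : ∀ {f g : ℂ → ℂ}, Continuous f → Continuous g → (∀ ε, ε ≠ 0 → f ε = g ε) →
      f 0 = g 0 := by
    intro f g hf hg hfg
    exact congrFun (hf.ext_on (dense_compl_singleton (0 : ℂ)) hg (fun ε hε => hfg ε hε)) 0
  rcases (by omega : d = 1 ∨ d = 2 ∨ 3 ≤ d) with rfl | rfl | hd3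
  · refine ⟨v 0, hv.ne_zero 0, hk 0, fun r => ?_⟩
    obtain ⟨G, hG, hG0, hGe⟩ := hkey r
    have := hdense (g := fun ε => ε * ((∑ i, r i * eval (t + ε • r) (h i)) ^ 2 *
        eval (t + ε • r) q)) hG
      (continuous_id.mul (((continuous_finsetSum _ fun i _ =>
        continuous_const.mul (hcont _ _)).pow 2).mul (hcont _ _)))
      (fun ε hε => mul_left_cancel₀ hε (by linear_combination hGe ε))
    rw [hG0, zero_mul, Matrix.det_fin_one] at this
    simpa [hκ] using this
  · let ℓ : (Fin 3 → ℂ) →ₗ[ℂ] ℂ := Fintype.linearCombination ℂ (fun i => eval t (h i))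
    have hℓ : ∀ s, ℓ s = ∑ i, s i * eval t (h i) := fun s => by
      simp [ℓ, Fintype.linearCombination_apply]
    let F : (Fin 5 → ℂ) → (Fin 5 → ℂ) → (Fin 3 → ℂ) →ₗ[ℂ] ℂ := fun x y =>
      Fintype.linearCombination ℂ (fun k => x ⬝ᵥ (A k).mulVec y)
    have hF : ∀ x y s, F x y s = x ⬝ᵥ (pencil A s).mulVec y := fun x y s => by
      simp [F, hlin, Fintype.linearCombination_apply]
    obtain ⟨x, y, hxy, hz⟩ := exists_common_zero_of_discr_eq_sq (F (v 0) (v 0)) (F (v 0) (v 1))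
      (F (v 1) (v 1)) ℓ (eval t q / κ) t ht (by simp [hF, hk]) (by simp [hF, hk])
      (by simp [hF, hk]) (fun s => by
        obtain ⟨G, hG, hG0, hGe⟩ := hkey s
        have := hdense (g := fun ε => (∑ i, s i * eval (t + ε • s) (h i)) ^ 2 *
            eval (t + ε • s) q) hG
          (((continuous_finsetSum _ fun i _ =>
            continuous_const.mul (hcont _ _)).pow 2).mul (hcont _ _))
          (fun ε hε => mul_left_cancel₀ (pow_ne_zero 2 hε) (hGe ε))
        simp only [hG0, zero_smul, add_zero, Matrix.det_fin_two, Matrix.of_apply] at this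
        rw [hF, hF, hF, hℓ, div_mul_eq_mul_div, eq_div_iff hκ]
        rw [dotProduct_mulVec_comm (pencil_isSymm hA s) (v 1) (v 0)] at this
        linear_combination this)
    refine ⟨x • v 0 + y • v 1, fun h0 => ?_, ?_, fun r => ?_⟩
    · have := LinearIndependent.pair_iff.1 (by
        convert hv using 1
        funext i; fin_cases i <;> rfl : LinearIndependent ℂ ![v 0, v 1]) x y h0
      tauto
    · simp [Matrix.mulVec_add, Matrix.mulVec_smul, hk]
    · rw [quadForm_comb (pencil_isSymm hA r)]
      have := hz r
      simp only [hF] at this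
      linear_combination this
  · obtain ⟨b, hb, hbt⟩ := exists_linearIndependent_extension (n := 3) (m := 1) (by norm_num)
      (fun _ => t) (.of_subsingleton 0 ht)
    have hbt : b 0 = t := hbt 0
    let u : Fin 3 → Fin 5 → ℂ := fun i => v (Fin.castLE hd3 i)
    have hu : LinearIndependent ℂ u := hv.comp _ (Fin.castLE_injective hd3)
    let D : Fin 3 → Matrix (Fin 3) (Fin 3) ℂ := fun k =>
      Matrix.of fun i j => u i ⬝ᵥ (pencil A (b k)).mulVec (u j)
    have hD : ∀ k, (D k).IsSymm := fun k => by
      ext i j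
      exact dotProduct_mulVec_comm (pencil_isSymm hA _) _ _
    obtain ⟨c, hc, h1, h2⟩ := exists_common_zero (hD 1) (hD 2)
    have hval : ∀ r, (∑ i, c i • u i) ⬝ᵥ (pencil A r).mulVec (∑ i, c i • u i) =
        c ⬝ᵥ (Matrix.of fun i j => u i ⬝ᵥ (pencil A r).mulVec (u j)).mulVec c := by
      intro r
      simp only [Matrix.mulVec_sum, Matrix.mulVec_smul, dotProduct_sum, sum_dotProduct,
        dotProduct_smul, smul_dotProduct, smul_eq_mul]
      simp only [dotProduct, Matrix.mulVec, Matrix.of_apply, Finset.mul_sum]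
      rw [Finset.sum_comm]
      refine Finset.sum_congr rfl fun i _ => Finset.sum_congr rfl fun j _ => ?_
      simp only [Finset.sum_mul, Finset.mul_sum]
      refine Finset.sum_congr rfl fun k _ => Finset.sum_congr rfl fun l _ => ?_
      ring
    have hker : (pencil A t).mulVec (∑ i, c i • u i) = 0 := by
      simp [Matrix.mulVec_sum, Matrix.mulVec_smul, u, hk]
    refine ⟨∑ i, c i • u i, fun h0 => hc (funext (Fintype.linearIndependent_iff.1 hu c h0)),
      hker, fun r => ?_⟩
    have hspan : r ∈ Submodule.span ℂ (Set.range b) := by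
      rw [hb.span_eq_top_of_card_eq_finrank' (by simp)]; trivial
    obtain ⟨a, rfl⟩ := (Submodule.mem_span_range_iff_exists_fun ℂ).1 hspan
    have hsum : pencil A (∑ i, a i • b i) = ∑ i, a i • pencil A (b i) := by
      simp only [pencil, Finset.sum_apply, Pi.smul_apply, Finset.sum_smul, Finset.smul_sum,
        smul_assoc]
      exact Finset.sum_comm
    have h0 : (∑ i, c i • u i) ⬝ᵥ (pencil A (b 0)).mulVec (∑ i, c i • u i) = 0 := by
      rw [hbt, hker, dotProduct_zero]
    have hall : ∀ k, (∑ i, c i • u i) ⬝ᵥ (pencil A (b k)).mulVec (∑ i, c i • u i) = 0 :=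
      fun k => by fin_cases k; exacts [h0, (hval _).trans h1, (hval _).trans h2]
    rw [hsum, Matrix.sum_mulVec, dotProduct_sum]
    exact Finset.sum_eq_zero fun k _ => by
      rw [Matrix.smul_mulVec, dotProduct_smul, hall k, smul_zero]

lemma eval_aeval_C_X (F : MvPolynomial (Fin 2) ℂ) (a z : ℂ) :
    (aeval ![Polynomial.C a, Polynomial.X] F : Polynomial ℂ).eval z = eval ![a, z] F := by
  have : (Polynomial.aeval z).comp (aeval ![Polynomial.C a, Polynomial.X]) =
      aeval (R := ℂ) ![a, z] := by
    apply MvPolynomial.algHom_ext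
    intro j
    fin_cases j <;> simp
  have := congrArg (fun φ => φ F) this
  simpa [Polynomial.coe_aeval_eq_eval, MvPolynomial.coe_aeval_eq_eval] using this

/-- A nonconstant polynomial in three variables has infinitely many pairwise linearly independent
zeros. -/
lemma exists_linearIndependent_zeros {p : MvPolynomial (Fin 3) ℂ} (hp : 0 < p.totalDegree) :
    ∃ T : ℕ → Fin 3 → ℂ, (∀ n, eval (T n) p = 0) ∧
      ∀ m n, m ≠ n → LinearIndependent ℂ ![T m, T n] := by
  obtain ⟨i, hi⟩ : ∃ i, 0 < degreeOf i p := by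
    by_contra! h
    refine hp.ne' (Nat.le_zero.1 (Finset.sup_le fun m hm => ?_))
    refine (Finset.sum_eq_zero fun j _ => ?_).le
    exact Nat.le_zero.1 ((monomial_le_degreeOf j hm).trans (h j))
  let σ := Equiv.swap (0 : Fin 3) i
  let P := finSuccEquiv ℂ 2 (rename σ p)
  have hP : 0 < P.natDegree := by
    have h := degreeOf_rename_of_injective (p := p) σ.injective i
    rw [show σ i = 0 from Equiv.swap_apply_right 0 i] at h
    rw [natDegree_finSuccEquiv, h]
    exact hi
  have hc : P.leadingCoeff ≠ 0 := by
    rw [Polynomial.leadingCoeff_ne_zero]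
    rintro h0
    simp [h0] at hP
  obtain ⟨y, hy⟩ : ∃ y : Fin 2 → ℂ, eval y (P.leadingCoeff * X 0) ≠ 0 := by
    by_contra! h
    exact mul_ne_zero hc (X_ne_zero 0) (MvPolynomial.funext fun y => by rw [h, map_zero])
  simp only [map_mul, eval_X] at hy
  have hy0 : y 0 ≠ 0 := right_ne_zero_of_mul hy
  let f : Polynomial ℂ := aeval ![Polynomial.C (y 0), Polynomial.X] P.leadingCoeff
  have hf : ∀ z, f.eval z = eval ![y 0, z] P.leadingCoeff := eval_aeval_C_X _ _
  have hf0 : f ≠ 0 := by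
    intro h0
    have h1 : ![y 0, y 1] = y := by funext j; fin_cases j <;> rfl
    have := hf (y 1)
    rw [h0, Polynomial.eval_zero, h1] at this
    exact left_ne_zero_of_mul hy this.symm
  have hinf : {z | f.eval z ≠ 0}.Infinite :=
    (Polynomial.finite_setOfPred_isRoot hf0).infinite_compl
  let Z := hinf.natEmbedding
  have hroot : ∀ n, ∃ x : ℂ, eval (Fin.cons x ![y 0, Z n] : Fin 3 → ℂ) (rename σ p) = 0 := by
    intro n
    have hn : eval ![y 0, Z n] P.leadingCoeff ≠ 0 := by
      rw [← hf]; exact (Z n).2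
    obtain ⟨x, hx⟩ := IsAlgClosed.exists_root (P.map (eval ![y 0, (Z n : ℂ)])) (by
      rw [Polynomial.degree_map_eq_of_leadingCoeff_ne_zero _ hn]
      exact (Polynomial.natDegree_pos_iff_degree_pos.1 hP).ne')
    exact ⟨x, by rw [eval_eq_eval_mv_eval']; exact hx⟩
  choose x hx using hroot
  refine ⟨fun n => (Fin.cons (x n) ![y 0, (Z n : ℂ)] : Fin 3 → ℂ) ∘ σ, fun n => ?_,
    fun m n hmn => ?_⟩
  · rw [← eval_rename]
    exact hx n
  · rw [LinearIndependent.pair_iff]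
    intro a b hab
    have hcoord : ∀ j, a * (Fin.cons (x m) ![y 0, (Z m : ℂ)] : Fin 3 → ℂ) j +
        b * (Fin.cons (x n) ![y 0, (Z n : ℂ)] : Fin 3 → ℂ) j = 0 := by
      intro j
      have := congrFun hab (σ.symm j)
      simpa using this
    have h1 := hcoord 1
    have h2 := hcoord 2
    simp only [show (1 : Fin 3) = Fin.succ 0 from rfl, show (2 : Fin 3) = Fin.succ 1 from rfl,
      Fin.cons_succ, Matrix.cons_val_zero, Matrix.cons_val_one] at h1 h2
    have hb : b = -a := by
      have : (a + b) * y 0 = 0 := by linear_combination h1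
      linear_combination (mul_eq_zero.1 this).resolve_right hy0
    have hz : (Z m : ℂ) - Z n ≠ 0 := by
      rw [sub_ne_zero]
      exact fun h => hmn (Z.injective (Subtype.ext h))
    have ha : a = 0 := by
      have : a * ((Z m : ℂ) - Z n) = 0 := by rw [hb] at h2; linear_combination h2
      exact (mul_eq_zero.1 this).resolve_right hz
    exact ⟨ha, by rw [hb, ha, neg_zero]⟩

/-- An element of a domain of transcendence degree at most `n` divides a nonzero polynomial in any
`n` given elements. -/
lemma exists_dvd_aeval_of_trdeg_le {R : Type} [CommRing R] [IsDomain R] [Algebra ℂ R] {n : ℕ}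
    (h : Algebra.trdeg ℂ R ≤ n) (x : Fin n → R) {γ : R} (hγ : γ ≠ 0) :
    ∃ F : MvPolynomial (Fin n) ℂ, F ≠ 0 ∧ γ ∣ aeval x F := by
  by_cases hx : AlgebraicIndependent ℂ x
  · have hb := hx.isTranscendenceBasis_of_trdeg_le_of_finite (by simpa using h)
    have := hb.isAlgebraic
    obtain ⟨r, hr, hd⟩ := (Algebra.IsAlgebraic.isAlgebraic
      (R := Algebra.adjoin ℂ (Set.range x)) γ).exists_nonzero_dvd
      (mem_nonZeroDivisors_of_ne_zero hγ)
    obtain ⟨r, hr'⟩ := r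
    have hmem := hr'
    rw [Algebra.adjoin_range_eq_range_aeval] at hmem
    obtain ⟨F, hF⟩ := hmem
    refine ⟨F, fun h0 => hr ?_, ?_⟩
    · ext
      simpa [h0] using hF.symm
    · change aeval x F = r at hF
      rw [hF]
      exact hd
  · rw [algebraicIndependent_iff] at hx
    push Not at hx
    obtain ⟨F, hF, hF0⟩ := hx
    exact ⟨F, hF0, by rw [hF]; exact dvd_zero _⟩

/-- Elements of a minimal prime over a radical ideal are annihilated, modulo the ideal, by an
element outside of the prime. -/
lemma exists_notMem_mul_mem_of_mem_minimalPrimes {R : Type*} [CommRing R] {I P : Ideal R}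
    (hI : I.IsRadical) (hP : P ∈ I.minimalPrimes) {f : R} (hf : f ∈ P) :
    ∃ g, g ∉ P ∧ g * f ∈ I := by
  have hp : P.IsPrime := hP.isPrime
  have h1 : algebraMap R (Localization.AtPrime P) f ∈
      (I.map (algebraMap R (Localization.AtPrime P))).radical := by
    rw [IsLocalization.AtPrime.radical_map_of_mem_minimalPrimes _ P I hP]
    exact Ideal.mem_map_of_mem _ hf
  obtain ⟨n, hn⟩ := h1
  rw [← map_pow, IsLocalization.algebraMap_mem_map_algebraMap_iff P.primeCompl] at hn
  obtain ⟨t, ht, htf⟩ := hn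
  refine ⟨t, ht, hI ⟨n + 1, ?_⟩⟩
  rw [show (t * f) ^ (n + 1) = (t ^ n * f) * (t * f ^ n) by ring]
  exact I.mul_mem_left _ htf

lemma pderiv_mem_supported {σ : Type*} {s : Set σ} {f : MvPolynomial σ ℂ} (i : σ)
    (hf : f ∈ supported ℂ s) : pderiv i f ∈ supported ℂ s := by
  classical
  rw [supported_eq_adjoin_X] at hf
  induction hf using Algebra.adjoin_induction with
  | mem x hx =>
    obtain ⟨j, -, rfl⟩ := hx
    rw [pderiv_X, Pi.single_apply]
    split_ifs
    exacts [one_mem _, zero_mem _]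
  | algebraMap r => simp [algebraMap_eq]
  | add x y _ _ hx hy => rw [map_add]; exact add_mem hx hy
  | mul x y h1 h2 hx hy =>
    rw [pderiv_mul]
    rw [← supported_eq_adjoin_X] at h1 h2
    exact add_mem (mul_mem hx h2) (mul_mem h1 hy)

lemma totalDegree_pderiv_lt {σ : Type*} {f : MvPolynomial σ ℂ} {i : σ} (h : pderiv i f ≠ 0) :
    (pderiv i f).totalDegree < f.totalDegree := by
  have key : ∀ m ∈ (pderiv i f).support, (m.sum fun _ e => e) < f.totalDegree := by
    intro m hm
    rw [mem_support_iff, coeff_pderiv] at hm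
    have := le_totalDegree (mem_support_iff.2 (left_ne_zero_of_mul hm))
    rw [Finsupp.sum_add_index' (by simp) (by simp)] at this
    simp only [Finsupp.sum_single_index] at this
    omega
  obtain ⟨m, hm⟩ := support_nonempty.2 h
  exact (Finset.sup_lt_iff ((Nat.zero_le _).trans_lt (key m hm))).2 key

lemma mem_supported_of_pderiv_eq_zero {σ : Type*} {s : Set σ} {f : MvPolynomial σ ℂ} {i : σ}
    (hf : f ∈ supported ℂ (insert i s)) (h : pderiv i f = 0) : f ∈ supported ℂ s := by
  rw [mem_supported] at hf ⊢
  intro j hj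
  refine (hf hj).resolve_left ?_
  rintro rfl
  obtain ⟨m, hm, hjm⟩ := (mem_vars_iff_mem_support j).1 hj
  have hle : Finsupp.single j 1 ≤ m :=
    Finsupp.single_le_iff.2 (Nat.one_le_iff_ne_zero.2 (Finsupp.mem_support_iff.1 hjm))
  have h1 := coeff_pderiv (i := j) f (m - Finsupp.single j 1)
  rw [h, coeff_zero, tsub_add_cancel_of_le hle] at h1
  exact mul_ne_zero (mem_support_iff.1 hm) (Nat.cast_add_one_ne_zero (R := ℂ) _) h1.symm

lemma exists_maximal_free_variables (P : Ideal Quin) [hP : P.IsPrime] :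
    ∃ T : Finset (Fin 5), (T.card : Cardinal) ≤ Algebra.trdeg ℂ (Quin ⧸ P) ∧ ∀ k ∉ T, ∃ H ∈ P,
      pderiv k H ∉ P ∧ ∀ l ∉ T, l ≠ k → pderiv l H = 0 := by
  let S : Set (Finset (Fin 5)) := {T | ∀ p ∈ supported ℂ (T : Set (Fin 5)), p ∈ P → p = 0}
  have hne : S.Nonempty := by
    refine ⟨∅, fun p hp hpP => ?_⟩
    rw [Finset.coe_empty, supported_empty] at hp
    obtain ⟨c, rfl⟩ := hp
    by_contra h0
    have hc : c ≠ 0 := fun h => h0 (by simp [h])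
    exact hP.ne_top (P.eq_top_of_isUnit_mem hpP ((isUnit_iff_ne_zero.2 hc).map (algebraMap ℂ Quin)))
  obtain ⟨T, hT⟩ := S.toFinite.exists_maximal hne
  refine ⟨T, ?_, fun k hk => ?_⟩
  · have hind : AlgebraicIndependent ℂ
        ((fun i => Ideal.Quotient.mk P (X i)) ∘ (Subtype.val : ↥(T : Set (Fin 5)) → Fin 5)) := by
      rw [algebraicIndependent_comp_subtype]
      intro p hp hp0
      refine hT.1 p hp (Ideal.Quotient.eq_zero_iff_mem.1 ?_)
      rw [← hp0]
      have : (Ideal.Quotient.mkₐ ℂ P) = aeval (fun i => Ideal.Quotient.mk P (X i)) :=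
        MvPolynomial.algHom_ext fun i => by simp
      exact congrArg (fun φ => φ p) this
    simpa using hind.cardinalMk_le_trdeg
  · have hk' : insert k T ∉ S := fun h => hk (hT.2 h (Finset.subset_insert k T)
      (Finset.mem_insert_self k T))
    simp only [S, Set.mem_ofPred_eq, not_forall] at hk'
    obtain ⟨p, hp, hpP, hp0⟩ := hk'
    obtain ⟨H, ⟨hHs, hHP, hH0⟩, hmin⟩ := (measure (totalDegree (R := ℂ) (σ := Fin 5))).wf.has_min
      {p | p ∈ supported ℂ ((insert k T : Finset (Fin 5)) : Set (Fin 5)) ∧ p ∈ P ∧ p ≠ 0}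
      ⟨p, hp, hpP, hp0⟩
    refine ⟨H, hHP, fun hd => ?_, fun l hl hlk => pderiv_eq_zero_of_notMem_vars fun hv => ?_⟩
    · by_cases h0 : pderiv k H = 0
      · rw [Finset.coe_insert] at hHs
        exact hH0 (hT.1 H (mem_supported_of_pderiv_eq_zero hHs h0) hHP)
      · exact hmin _ ⟨pderiv_mem_supported k hHs, hd, h0⟩ (totalDegree_pderiv_lt h0)
    · have := mem_supported.1 hHs hv
      simp [hl, hlk] at this

/-- The Jacobian criterion: three generators of a radical ideal have a nonvanishing Jacobian minor
along every component of dimension at most two in affine 5-space. -/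
lemma exists_jacobian_minor_notMem {Q : Fin 3 → Quin}
    (hI : (Ideal.span (Set.range Q)).IsRadical) {P : Ideal Quin}
    (hP : P ∈ (Ideal.span (Set.range Q)).minimalPrimes)
    (htr : Algebra.trdeg ℂ (Quin ⧸ P) ≤ 2) :
    ∃ e : Fin 3 → Fin 5, (Matrix.of fun k l => pderiv (e l) (Q k)).det ∉ P := by
  have hp : P.IsPrime := hP.isPrime
  obtain ⟨T, hT, hH⟩ := exists_maximal_free_variables P
  have hcard : T.card ≤ 2 := by exact_mod_cast hT.trans htr
  obtain ⟨U, hU, hU3⟩ := Finset.exists_subset_card_eq (s := Tᶜ) (n := 3) (by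
    rw [Finset.card_compl, Fintype.card_fin]; omega)
  let e := U.orderEmbOfFin hU3
  have he : ∀ i, e i ∉ T := fun i => Finset.mem_compl.1 (hU (Finset.orderEmbOfFin_mem U hU3 i))
  choose H hHP hHd hHl using fun i => hH (e i) (he i)
  choose g hgP hgH using fun i => exists_notMem_mul_mem_of_mem_minimalPrimes hI hP (hHP i)
  have := fun i => Ideal.mem_span_range_iff_exists_fun.1 (hgH i)
  choose h hh using this
  refine ⟨e, fun hdet => ?_⟩
  let φ := Ideal.Quotient.mk P
  have hQP : ∀ k, φ (Q k) = 0 := fun k =>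
    Ideal.Quotient.eq_zero_iff_mem.2 (hP.1.2 (Ideal.subset_span ⟨k, rfl⟩))
  have hmat : (Matrix.of h).map φ * (Matrix.of fun k l => pderiv (e l) (Q k)).map φ =
      Matrix.diagonal fun i => φ (g i * pderiv (e i) (H i)) := by
    ext i l
    have hd := congrArg (fun f => φ (pderiv (e l) f)) (hh i)
    have hH0 : φ (H i) = 0 := Ideal.Quotient.eq_zero_iff_mem.2 (hHP i)
    simp only [map_sum, pderiv_mul, map_add, map_mul, hQP, hH0, mul_zero, zero_add] at hd
    rw [Matrix.mul_apply, Matrix.diagonal_apply]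
    simp only [Matrix.map_apply, Matrix.of_apply]
    rw [hd]
    split_ifs with hil
    · rw [hil, map_mul]
    · rw [hHl i (e l) (he l) (fun h => hil (e.injective h).symm), map_zero, mul_zero]
  have hdet' := congrArg Matrix.det hmat
  rw [Matrix.det_mul, Matrix.det_diagonal, ← RingHom.mapMatrix_apply, ← RingHom.mapMatrix_apply,
    ← RingHom.map_det, ← RingHom.map_det, show φ _ = 0 from Ideal.Quotient.eq_zero_iff_mem.2 hdet,
    mul_zero] at hdet'
  obtain ⟨i, -, hi⟩ := Finset.prod_eq_zero_iff.1 hdet'.symm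
  exact (hp.mem_or_mem (Ideal.Quotient.eq_zero_iff_mem.1 hi)).elim (hgP i) (hHd i)

lemma eval_pderiv_quadPoly {n : ℕ} {B : Matrix (Fin n) (Fin n) ℂ} (hB : B.IsSymm) (l : Fin n)
    (x : Fin n → ℂ) : eval x (pderiv l (quadPoly B)) = 2 * B.mulVec x l := by
  simp only [quadPoly, map_sum, pderiv_mul, pderiv_C, pderiv_X, map_add, map_mul, eval_C,
    eval_X, Pi.single_apply, mul_add,
    Finset.sum_add_distrib, ite_mul, mul_ite, one_mul, mul_one, zero_mul, mul_zero, zero_add,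
    Finset.sum_ite_eq', Finset.sum_ite_irrel, Finset.mem_univ, if_true, Finset.sum_const_zero]
  rw [two_mul, Matrix.mulVec, dotProduct]
  congr 1
  exact Finset.sum_congr rfl fun i _ => by rw [hB.apply]

/-- If all components of the zero locus of a radical ideal with three generators are curves (or
points) in affine 5-space up to scaling, the singular points lie over a plane curve. -/
lemma exists_vanishing_on_singular_points {Q : Fin 3 → Quin}
    (hI : (Ideal.span (Set.range Q)).IsRadical)
    (htr : ∀ P ∈ (Ideal.span (Set.range Q)).minimalPrimes, Algebra.trdeg ℂ (Quin ⧸ P) ≤ 2)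
    (i j : Fin 5) :
    ∃ F : MvPolynomial (Fin 2) ℂ, F ≠ 0 ∧ ∀ v : Fin 5 → ℂ, (∀ k, eval v (Q k) = 0) →
      (∃ t : Fin 3 → ℂ, t ≠ 0 ∧ ∀ l, ∑ k, t k * eval v (pderiv l (Q k)) = 0) →
      eval ![v i, v j] F = 0 := by
  set I := Ideal.span (Set.range Q) with hIdef
  have hfin := I.finite_minimalPrimes_of_isNoetherianRing
  have hloc : ∀ P ∈ I.minimalPrimes, ∃ F : MvPolynomial (Fin 2) ℂ, F ≠ 0 ∧
      ∀ v : Fin 5 → ℂ, P ≤ RingHom.ker (eval v) →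
      (∃ t : Fin 3 → ℂ, t ≠ 0 ∧ ∀ l, ∑ k, t k * eval v (pderiv l (Q k)) = 0) →
      eval ![v i, v j] F = 0 := by
    intro P hP
    have hp : P.IsPrime := hP.isPrime
    obtain ⟨e, he⟩ := exists_jacobian_minor_notMem hI hP (htr P hP)
    set J : Matrix (Fin 3) (Fin 3) Quin := Matrix.of fun k l => pderiv (e l) (Q k) with hJ
    obtain ⟨F, hF, hd⟩ := exists_dvd_aeval_of_trdeg_le (n := 2) (htr P hP)
      (fun k => Ideal.Quotient.mk P (![X i, X j] k))
      (γ := Ideal.Quotient.mk P J.det) (fun h => he (Ideal.Quotient.eq_zero_iff_mem.1 h))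
    refine ⟨F, hF, fun v hv ⟨t, ht, hts⟩ => ?_⟩
    obtain ⟨γ, hγ⟩ := hd
    obtain ⟨g, rfl⟩ := Ideal.Quotient.mk_surjective γ
    have h1 : aeval (fun k => Ideal.Quotient.mk P (![X i, X j] k)) F =
        Ideal.Quotient.mk P (aeval (![X i, X j] : Fin 2 → Quin) F) := by
      have : aeval (fun k => Ideal.Quotient.mk P (![X i, X j] k)) =
          (Ideal.Quotient.mkₐ ℂ P).comp (aeval (![X i, X j] : Fin 2 → Quin)) :=
        MvPolynomial.algHom_ext fun j => by simp
      exact congrArg (fun φ => φ F) this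
    rw [h1, ← map_mul, Ideal.Quotient.eq] at hγ
    have h2 := hv hγ
    rw [RingHom.mem_ker, map_sub, map_mul] at h2
    have h3 : eval v J.det = 0 := by
      rw [RingHom.map_det]
      refine Matrix.exists_vecMul_eq_zero_iff.1 ⟨t, ht, ?_⟩
      funext l
      exact hts (e l)
    have h4 : eval v (aeval (![X i, X j] : Fin 2 → Quin) F) = eval ![v i, v j] F := by
      have : (aeval (R := ℂ) v).comp (aeval (![X i, X j] : Fin 2 → Quin)) = aeval ![v i, v j] := by
        apply MvPolynomial.algHom_ext
        intro j
        fin_cases j <;> simp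
      have := congrArg (fun φ => φ F) this
      simpa [MvPolynomial.coe_aeval_eq_eval] using this
    rwa [h3, zero_mul, sub_zero, h4] at h2
  choose! F hF0 hF using hloc
  refine ⟨∏ P ∈ hfin.toFinset, F P, Finset.prod_ne_zero_iff.2 fun P hP =>
    hF0 P (hfin.mem_toFinset.1 hP), fun v hv ht => ?_⟩
  have hker : (RingHom.ker (eval v)).IsPrime := RingHom.ker_isPrime _
  obtain ⟨P, hP, hPv⟩ := Ideal.exists_minimalPrimes_le (I := I) (J := RingHom.ker (eval v)) (by
    rw [hIdef, Ideal.span_le]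
    rintro _ ⟨k, rfl⟩
    exact hv k)
  rw [map_prod]
  exact Finset.prod_eq_zero (hfin.mem_toFinset.2 hP) (hF P hP v hPv ht)

/-- A radical net of quadrics, none of whose components is a surface, does not have infinitely many
singular base points. -/
lemma MatStable.exists_trdeg_gt {A : Fin 3 → Matrix (Fin 5) (Fin 5) ℂ} (hst : MatStable A)
    (hA : ∀ k, (A k).IsSymm)
    (hI : (Ideal.span (Set.range fun k => quadPoly (A k))).IsRadical)
    {T : ℕ → Fin 3 → ℂ} (hT : ∀ m n, m ≠ n → LinearIndependent ℂ ![T m, T n])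
    {v : ℕ → Fin 5 → ℂ} (hv0 : ∀ n, v n ≠ 0) (hker : ∀ n, (pencil A (T n)).mulVec (v n) = 0)
    (hbase : ∀ n r, v n ⬝ᵥ (pencil A r).mulVec (v n) = 0) :
    ∃ P ∈ (Ideal.span (Set.range fun k => quadPoly (A k))).minimalPrimes,
      2 < Algebra.trdeg ℂ (Quin ⧸ P) := by
  by_contra! htr
  have hT0 : ∀ n, T n ≠ 0 := fun n => (hT n (n + 1) (by omega)).ne_zero 0
  choose F hF0 hF using exists_vanishing_on_singular_points hI htr
  have hvanish : ∀ n (c : ℂ) i j, eval ![(c • v n) i, (c • v n) j] (F i j) = 0 := by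
    intro n c i j
    refine hF i j (c • v n) (fun k => ?_) ⟨T n, hT0 n, fun l => ?_⟩
    · have := hbase n (Pi.single k 1)
      simp only [pencil, Pi.single_apply, ite_smul, one_smul, zero_smul, Finset.sum_ite_eq',
        Finset.mem_univ, if_true] at this
      rw [eval_quadPoly, Matrix.mulVec_smul, dotProduct_smul, smul_dotProduct, this]
      simp
    · have := congrFun (hker n) l
      simp only [pencil, Matrix.sum_mulVec, Finset.sum_apply, Matrix.smul_mulVec, Pi.smul_apply,
        smul_eq_mul, Pi.zero_apply] at this
      simp only [eval_pderiv_quadPoly (hA _), Matrix.mulVec_smul, Pi.smul_apply, smul_eq_mul]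
      calc _ = 2 * c * ∑ k, T n k * (A k).mulVec (v n) l := by
            rw [Finset.mul_sum]; exact Finset.sum_congr rfl fun _ _ => by ring
        _ = 0 := by rw [this, mul_zero]
  have hne : ∀ n, ∃ i, v n i ≠ 0 := fun n => Function.ne_iff.1 (hv0 n)
  choose ι hι using hne
  obtain ⟨i, hi⟩ := Finite.exists_infinite_fiber ι
  have hi : (ι ⁻¹' {i}).Infinite := Set.infinite_coe_iff.1 hi
  obtain ⟨y, hy⟩ : ∃ y : Fin 2 → ℂ, eval y (X 0 * ∏ j, F i j) ≠ 0 := by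
    by_contra! h
    exact mul_ne_zero (X_ne_zero 0) (Finset.prod_ne_zero_iff.2 fun j _ => hF0 i j)
      (MvPolynomial.funext fun y => by rw [h, map_zero])
  rw [map_mul, map_prod, eval_X] at hy
  let f : Fin 5 → Polynomial ℂ := fun j => aeval ![Polynomial.C (y 0), Polynomial.X] (F i j)
  have hf : ∀ j, f j ≠ 0 := by
    intro j h0
    have h1 : ![y 0, y 1] = y := by funext j; fin_cases j <;> rfl
    have h2 := eval_aeval_C_X (F i j) (y 0) (y 1)
    change (f j).eval _ = _ at h2
    rw [h0, Polynomial.eval_zero, h1] at h2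
    exact Finset.prod_ne_zero_iff.1 (right_ne_zero_of_mul hy) j (Finset.mem_univ j) h2.symm
  let u : ℕ → Fin 5 → ℂ := fun n => (y 0 / v n i) • v n
  have hfin : (Set.pi Set.univ fun j => {z | (f j).IsRoot z}).Finite :=
    Set.Finite.pi fun j => Polynomial.finite_setOfPred_isRoot (hf j)
  have hmaps : Set.MapsTo u (ι ⁻¹' {i}) (Set.pi Set.univ fun j => {z | (f j).IsRoot z}) := by
    intro n hn j _
    have hvi : v n i ≠ 0 := by
      have := hι n
      rwa [show ι n = i from hn] at this
    have h1 := hvanish n (y 0 / v n i) i j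
    rw [show ((y 0 / v n i) • v n) i = y 0 by simp [hvi], ← eval_aeval_C_X] at h1
    exact h1
  obtain ⟨m, hm, n, hn, hmn, he⟩ := hi.exists_ne_map_eq_of_mapsTo hmaps hfin
  have hum : u m ≠ 0 := by
    have hvi : v m i ≠ 0 := by
      have := hι m
      rwa [show ι m = i from hm] at this
    exact smul_ne_zero (div_ne_zero (left_ne_zero_of_mul hy) hvi) (hv0 m)
  refine hst.not_singular_pencil hA (u m) hum ![T m, T n] (hT m n hmn) (fun k => ?_) fun r => ?_
  · have h1 : ∀ n, (pencil A (T n)).mulVec (u n) = 0 := fun n => by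
      simp [u, Matrix.mulVec_smul, hker]
    fin_cases k
    · exact h1 m
    · change (pencil A (T n)).mulVec (u m) = 0
      rw [he, h1]
  · simp [u, Matrix.mulVec_smul, hbase]

/-- The grading of a polynomial ring, recorded by an auxiliary variable. -/
noncomputable def gradingHom (σ : Type*) :
    MvPolynomial σ ℂ →ₐ[ℂ] Polynomial (MvPolynomial σ ℂ) :=
  aeval fun i => Polynomial.C (X i) * Polynomial.X

lemma coeff_gradingHom {σ : Type*} (f : MvPolynomial σ ℂ) (d : ℕ) :
    (gradingHom σ f).coeff d = homogeneousComponent d f := by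
  induction f using MvPolynomial.induction_on' with
  | monomial m r =>
    have h1 : gradingHom σ (monomial m r) = Polynomial.monomial m.degree (monomial m r) := by
      rw [gradingHom, aeval_monomial]
      simp only [mul_pow, Finsupp.prod_mul]
      rw [← Polynomial.C_mul_X_pow_eq_monomial, monomial_eq, Finsupp.degree, Finsupp.prod,
        Finsupp.prod, Finsupp.prod, Finset.prod_pow_eq_pow_sum, map_mul, map_prod]
      simp only [map_pow]
      exact (mul_assoc _ _ _).symm
    rw [h1, Polynomial.coeff_monomial]
    split_ifs with h
    · rw [homogeneousComponent_of_mem (isHomogeneous_monomial r rfl), if_pos h.symm]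
    · rw [homogeneousComponent_of_mem (isHomogeneous_monomial r rfl), if_neg (Ne.symm h)]
  | add p q hp hq => rw [map_add, map_add, Polynomial.coeff_add, hp, hq]

lemma gradingHom_of_isHomogeneous {σ : Type*} {f : MvPolynomial σ ℂ} {n : ℕ}
    (hf : f.IsHomogeneous n) : gradingHom σ f = Polynomial.monomial n f := by
  ext1 d
  rw [coeff_gradingHom, homogeneousComponent_of_mem hf, Polynomial.coeff_monomial]
  simp only [eq_comm]

lemma isHomogeneous_of_mul_left {σ : Type*} {f g : MvPolynomial σ ℂ} {n : ℕ}
    (h : (f * g).IsHomogeneous n) (h0 : f * g ≠ 0) : f.IsHomogeneous f.totalDegree := by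
  suffices H : ∃ a, f.IsHomogeneous a by
    obtain ⟨a, ha⟩ := H
    rwa [ha.totalDegree (left_ne_zero_of_mul h0)]
  have h1 := gradingHom_of_isHomogeneous h
  rw [map_mul] at h1
  set F := gradingHom σ f
  set G := gradingHom σ g
  have hFG : F * G ≠ 0 := by
    rw [h1]
    exact (Polynomial.monomial_eq_zero_iff _ _).not.2 h0
  have hF := left_ne_zero_of_mul hFG
  have hG := right_ne_zero_of_mul hFG
  have h2 := Polynomial.natDegree_mul hF hG
  have h3 := Polynomial.natTrailingDegree_mul hF hG
  rw [h1, Polynomial.natDegree_monomial_eq _ h0] at h2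
  rw [h1, Polynomial.natTrailingDegree_monomial h0] at h3
  have h4 := F.natTrailingDegree_le_natDegree
  have h5 := G.natTrailingDegree_le_natDegree
  refine ⟨F.natDegree, fun m hm => ?_⟩
  by_contra hne
  rw [show Finsupp.weight 1 m = m.degree from
    DFunLike.congr_fun (Finsupp.degree_eq_weight_one (R := ℕ)).symm m] at hne
  have h6 : F.coeff m.degree = 0 := by
    rcases lt_or_gt_of_ne hne with h | h
    · exact Polynomial.coeff_eq_zero_of_lt_natTrailingDegree (by change m.degree < _ at h; omega)
    · exact Polynomial.coeff_eq_zero_of_natDegree_lt h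
  rw [coeff_gradingHom] at h6
  apply hm
  have := congrArg (coeff m) h6
  rwa [coeff_homogeneousComponent, if_pos rfl, coeff_zero] at this

lemma isHomogeneous_of_mul_right {σ : Type*} {f g : MvPolynomial σ ℂ} {a b : ℕ}
    (hf : f.IsHomogeneous a) (h : (f * g).IsHomogeneous (a + b)) (hf0 : f ≠ 0) :
    g.IsHomogeneous b := by
  by_cases hg : g = 0
  · rw [hg]; exact isHomogeneous_zero _ _ _
  have h0 := mul_ne_zero hf0 hg
  have h1 := isHomogeneous_of_mul_left (by rwa [mul_comm] at h) (by rwa [mul_comm] at h0)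
  have h2 := (hf.mul h1).inj_right h h0
  rwa [Nat.add_left_cancel h2] at h1

lemma aeval_eq_zero_of_isHomogeneous_one {D : Type*} [CommRing D] [Algebra ℂ D] {n : ℕ}
    {η : Fin n → D} (hη : LinearIndependent ℂ η) {f : MvPolynomial (Fin n) ℂ}
    (hf : f.IsHomogeneous 1) (h0 : aeval η f = 0) : f = 0 := by
  rw [← mem_homogeneousSubmodule, homogeneousSubmodule_one_eq_span_X,
    Submodule.mem_span_range_iff_exists_fun] at hf
  obtain ⟨c, rfl⟩ := hf
  rw [map_sum] at h0
  simp only [map_smul, aeval_X] at h0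
  have := Fintype.linearIndependent_iff.1 hη _ h0
  simp [this]

lemma isUnit_of_totalDegree_eq_zero {σ : Type*} {f : MvPolynomial σ ℂ} (h0 : f ≠ 0)
    (hf : f.totalDegree = 0) : IsUnit f := by
  rw [totalDegree_eq_zero_iff_eq_C] at hf
  rw [hf]
  refine (isUnit_iff_ne_zero.2 fun h => h0 ?_).map C
  rw [hf, h, map_zero]

lemma irreducible_of_isHomogeneous_two {D : Type*} [CommRing D] [IsDomain D] [Algebra ℂ D] {n : ℕ}
    {η : Fin n → D} (hη : LinearIndependent ℂ η) {q : MvPolynomial (Fin n) ℂ}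
    (hq : q.IsHomogeneous 2) (hq0 : q ≠ 0) (h0 : aeval η q = 0) : Irreducible q := by
  refine ⟨fun hu => ?_, fun f g hfg => ?_⟩
  · have := (isUnit_iff_totalDegree_of_isReduced.1 hu).2
    rw [hq.totalDegree hq0] at this
    omega
  · subst hfg
    have hf := left_ne_zero_of_mul hq0
    have hg := right_ne_zero_of_mul hq0
    have hfh := isHomogeneous_of_mul_left hq hq0
    rw [mul_comm] at hq hq0
    have hgh := isHomogeneous_of_mul_left hq hq0
    have hd := totalDegree_mul_of_isDomain hg hf
    rw [hq.totalDegree hq0] at hd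
    by_cases hf1 : f.totalDegree = 0
    · exact Or.inl (isUnit_of_totalDegree_eq_zero hf hf1)
    by_cases hg1 : g.totalDegree = 0
    · exact Or.inr (isUnit_of_totalDegree_eq_zero hg hg1)
    rw [show f.totalDegree = 1 by omega] at hfh
    rw [show g.totalDegree = 1 by omega] at hgh
    rw [map_mul] at h0
    rcases mul_eq_zero.1 h0 with h | h
    · exact absurd (aeval_eq_zero_of_isHomogeneous_one hη hfh h) hf
    · exact absurd (aeval_eq_zero_of_isHomogeneous_one hη hgh h) hg

lemma natCast_succ_le_of_lt {n : ℕ} {c : Cardinal} (h : (n : Cardinal) < c) :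
    ((n + 1 : ℕ) : Cardinal) ≤ c := by
  rw [Nat.cast_add, Nat.cast_one, ← Cardinal.succ_natCast]
  exact Order.succ_le_of_lt h

lemma isAlgebraic_of_adjoin_eq_top {D : Type*} [CommRing D] [IsDomain D] [Algebra ℂ D] {s : Set D}
    (h : Algebra.adjoin ℂ s = ⊤) : Algebra.IsAlgebraic (Algebra.adjoin ℂ s) D :=
  ⟨fun x => isAlgebraic_algebraMap (⟨x, h ▸ Algebra.mem_top⟩ : Algebra.adjoin ℂ s)⟩

lemma exists_algebraicIndependent_comp {D : Type} [CommRing D] [IsDomain D] [Algebra ℂ D] {n : ℕ}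
    (η : Fin n → D) [Algebra.IsAlgebraic (Algebra.adjoin ℂ (Set.range η)) D]
    (htr : 2 < Algebra.trdeg ℂ D) : ∃ e : Fin 3 → Fin n, AlgebraicIndependent ℂ (η ∘ e) := by
  obtain ⟨t, hts, ht⟩ := exists_isTranscendenceBasis_subset (R := ℂ) (Set.range η)
  rw [← ht.cardinalMk_eq_trdeg] at htr
  have h3 : Cardinal.mk (Fin 3) ≤ Cardinal.mk t := by
    rw [Cardinal.mk_fin]
    exact natCast_succ_le_of_lt (n := 2) (by simpa using htr)
  obtain ⟨f⟩ := h3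
  choose e he using fun i => hts (f i).2
  refine ⟨e, ?_⟩
  have := ht.1.comp f f.injective
  convert this using 1
  funext i
  exact he i

lemma trdeg_quotient_span_singleton_le {q : MvPolynomial (Fin 4) ℂ} (hq : Prime q) :
    Algebra.trdeg ℂ (MvPolynomial (Fin 4) ℂ ⧸ Ideal.span {q}) ≤ (3 : ℕ) := by
  have : (Ideal.span {q}).IsPrime := (Ideal.span_singleton_prime hq.ne_zero).2 hq
  set R := MvPolynomial (Fin 4) ℂ ⧸ Ideal.span {q}
  by_contra! h
  have h4 : Cardinal.mk (Fin 4) ≤ Algebra.trdeg ℂ R := by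
    rw [Cardinal.mk_fin]
    exact natCast_succ_le_of_lt h
  let x : Fin 4 → R := fun i => Ideal.Quotient.mk _ (X i)
  have hx : aeval x = Ideal.Quotient.mkₐ ℂ (Ideal.span {q}) :=
    MvPolynomial.algHom_ext fun j => aeval_X _ _
  have htop : Algebra.adjoin ℂ (Set.range x) = ⊤ := by
    rw [Algebra.adjoin_range_eq_range_aeval, hx, AlgHom.range_eq_top]
    exact Ideal.Quotient.mkₐ_surjective _ _
  have halg : Algebra.IsAlgebraic (Algebra.adjoin ℂ (Set.range x)) R :=
    isAlgebraic_of_adjoin_eq_top htop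
  have hb := Algebra.IsAlgebraic.isTranscendenceBasis_of_le_trdeg_of_finite (R := ℂ) x h4
  apply hq.ne_zero
  apply hb.1
  rw [map_zero, hx]
  exact Ideal.Quotient.eq_zero_iff_mem.2 (Ideal.mem_span_singleton_self q)

/-- A quadratic form vanishing at linearly independent elements generating a threefold divides every
other polynomial vanishing there. -/
lemma dvd_of_aeval_eq_zero {D : Type} [CommRing D] [IsDomain D] [Algebra ℂ D] {η : Fin 4 → D}
    (hη : LinearIndependent ℂ η) [Algebra.IsAlgebraic (Algebra.adjoin ℂ (Set.range η)) D]
    (htr : 2 < Algebra.trdeg ℂ D) {q h : MvPolynomial (Fin 4) ℂ} (hq : q.IsHomogeneous 2)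
    (hq0 : q ≠ 0) (hqη : aeval η q = 0) (hhη : aeval η h = 0) : q ∣ h := by
  by_contra hdvd
  have hp := (irreducible_of_isHomogeneous_two hη hq hq0 hqη).prime
  have : (Ideal.span {q}).IsPrime := (Ideal.span_singleton_prime hp.ne_zero).2 hp
  obtain ⟨e, he⟩ := exists_algebraicIndependent_comp η htr
  obtain ⟨F, hF, γ, hγ⟩ := exists_dvd_aeval_of_trdeg_le (trdeg_quotient_span_singleton_le hp)
    (fun i => Ideal.Quotient.mk (Ideal.span {q}) (X (e i)))
    (γ := Ideal.Quotient.mk (Ideal.span {q}) h)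
    (fun h0 => hdvd (Ideal.mem_span_singleton.1 (Ideal.Quotient.eq_zero_iff_mem.1 h0)))
  obtain ⟨g, rfl⟩ := Ideal.Quotient.mk_surjective γ
  have h1 : aeval (fun i => Ideal.Quotient.mk (Ideal.span {q}) (X (e i))) F =
      Ideal.Quotient.mk (Ideal.span {q}) (rename e F) := by
    have : aeval (fun i => Ideal.Quotient.mk (Ideal.span {q}) (X (e i))) =
        (Ideal.Quotient.mkₐ ℂ (Ideal.span {q})).comp (rename e) :=
      MvPolynomial.algHom_ext fun j => by simp
    exact congrArg (fun φ => φ F) this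
  rw [h1, ← map_mul, Ideal.Quotient.eq, Ideal.mem_span_singleton] at hγ
  obtain ⟨c, hc⟩ := hγ
  have h2 := congrArg (aeval η) hc
  rw [map_sub, map_mul, map_mul, hqη, hhη, zero_mul, zero_mul, sub_zero, aeval_rename] at h2
  exact hF (he (by rw [h2, map_zero]))

lemma linearIndependent_vecMul {m n : ℕ} {ι : Type*} {W : Matrix (Fin m) (Fin n) ℂ}
    (hW : LinearIndependent ℂ W.row) {v : ι → Fin m → ℂ} (hv : LinearIndependent ℂ v) :
    LinearIndependent ℂ fun i => Matrix.vecMul (v i) W :=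
  hv.map' W.vecMulLinear (LinearMap.ker_eq_bot.2 (Matrix.vecMul_injective_iff.2 hW))

lemma dotProduct_congr_mulVec {m n : ℕ} (B : Matrix (Fin n) (Fin n) ℂ)
    (W : Matrix (Fin m) (Fin n) ℂ) (x y : Fin m → ℂ) :
    x ⬝ᵥ (W * B * W.transpose).mulVec y = Matrix.vecMul x W ⬝ᵥ B.mulVec (Matrix.vecMul y W) := by
  rw [← Matrix.mulVec_mulVec, ← Matrix.mulVec_mulVec, Matrix.mulVec_transpose,
    Matrix.dotProduct_mulVec]

lemma pencil_congr (A : Fin 3 → Matrix (Fin 5) (Fin 5) ℂ) (S : Matrix (Fin 3) (Fin 3) ℂ)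
    (W : Matrix (Fin 5) (Fin 5) ℂ) (r : Fin 3 → ℂ) :
    pencil (fun k => W * pencil A (S k) * W.transpose) r =
      W * pencil A (Matrix.vecMul r S) * W.transpose := by
  simp only [pencil, Matrix.mul_sum, Matrix.sum_mul, Matrix.mul_smul, Matrix.smul_mul,
    Finset.smul_sum, smul_smul, Matrix.vecMul, dotProduct, Finset.sum_smul]
  exact Finset.sum_comm

lemma MatStable.congr {A : Fin 3 → Matrix (Fin 5) (Fin 5) ℂ} (hst : MatStable A)
    {S : Matrix (Fin 3) (Fin 3) ℂ} (hS : LinearIndependent ℂ S.row)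
    {W : Matrix (Fin 5) (Fin 5) ℂ} (hW : LinearIndependent ℂ W.row) :
    MatStable fun k => W * pencil A (S k) * W.transpose := by
  intro s hs v hv ρ w hρ hw
  obtain ⟨k, i, j, hlt, hne⟩ := hst _ (linearIndependent_vecMul hS hs) _
    (linearIndependent_vecMul hW hv) ρ w hρ hw
  exact ⟨k, i, j, hlt, by rwa [pencil_congr, dotProduct_congr_mulVec]⟩

lemma aeval_quadPoly_eq_dotProduct {D : Type*} [CommRing D] [Algebra ℂ D] {n : ℕ}
    (B : Matrix (Fin n) (Fin n) ℂ) (η : Fin n → D) :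
    aeval η (quadPoly B) = η ⬝ᵥ (B.map (algebraMap ℂ D)).mulVec η := by
  rw [aeval_quadPoly]
  simp only [dotProduct, Matrix.mulVec, Finset.mul_sum, Matrix.map_apply]
  exact Finset.sum_congr rfl fun i _ => Finset.sum_congr rfl fun j _ => by ring

lemma aeval_quadPoly_congr {D : Type*} [CommRing D] [Algebra ℂ D] {m n : ℕ}
    (B : Matrix (Fin n) (Fin n) ℂ) (W : Matrix (Fin m) (Fin n) ℂ) {η : Fin m → D} {ξ : Fin n → D}
    (h : ∀ i, ξ i = ∑ j, W j i • η j) :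
    aeval η (quadPoly (W * B * W.transpose)) = aeval ξ (quadPoly B) := by
  have hξ : ξ = Matrix.vecMul η (W.map (algebraMap ℂ D)) := by
    funext i
    rw [h]
    simp only [Matrix.vecMul, dotProduct, Matrix.map_apply, Algebra.smul_def, mul_comm]
  rw [aeval_quadPoly_eq_dotProduct, aeval_quadPoly_eq_dotProduct, hξ, Matrix.map_mul,
    Matrix.map_mul, ← Matrix.mulVec_mulVec, ← Matrix.mulVec_mulVec, Matrix.transpose_map,
    Matrix.mulVec_transpose, Matrix.dotProduct_mulVec]

lemma exists_linearIndependent_generators {D : Type*} [CommRing D] [Algebra ℂ D] {n : ℕ}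
    (ξ : Fin n → D) : ∃ (d : ℕ) (η : Fin d → D) (W : Matrix (Fin d) (Fin n) ℂ),
      d = (Set.range ξ).finrank ℂ ∧ LinearIndependent ℂ η ∧ LinearIndependent ℂ W.row ∧
      ∀ i, ξ i = ∑ j, W j i • η j := by
  let V := Submodule.span ℂ (Set.range ξ)
  have : FiniteDimensional ℂ V := FiniteDimensional.span_of_finite ℂ (Set.finite_range ξ)
  let b := Module.finBasis ℂ V
  let x : Fin n → V := fun i => ⟨ξ i, Submodule.subset_span ⟨i, rfl⟩⟩
  refine ⟨_, fun j => (b j : D), Matrix.of fun j i => b.repr (x i) j, rfl, ?_, ?_, fun i => ?_⟩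
  · exact b.linearIndependent.map' V.subtype V.ker_subtype
  · rw [Fintype.linearIndependent_iff]
    intro c hc j
    have h1 : ∀ y : V, ∑ j, c j * b.repr y j = 0 := by
      rintro ⟨y, hy⟩
      induction hy using Submodule.span_induction with
      | mem y hy =>
        obtain ⟨i, rfl⟩ := hy
        simpa [Finset.sum_apply] using congrFun hc i
      | zero =>
        have : (⟨0, V.zero_mem⟩ : V) = 0 := rfl
        simp [this]
      | add y z hy hz h1 h2 =>
        have : (⟨y + z, V.add_mem hy hz⟩ : V) = ⟨y, hy⟩ + ⟨z, hz⟩ := rfl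
        rw [this]
        simp only [map_add, Finsupp.add_apply, mul_add, Finset.sum_add_distrib, h1, h2, add_zero]
      | smul a y hy h1 =>
        have : (⟨a • y, V.smul_mem a hy⟩ : V) = a • ⟨y, hy⟩ := rfl
        rw [this]
        simp only [map_smul, Finsupp.smul_apply, smul_eq_mul, mul_left_comm, ← Finset.mul_sum, h1,
          mul_zero]
    simpa [Finsupp.single_apply] using h1 (b j)
  · have := congrArg V.subtype (b.sum_repr (x i))
    rw [map_sum] at this
    exact this.symm

lemma exists_linearIndependent_coordinates {D : Type*} [CommRing D] [Algebra ℂ D] {n : ℕ}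
    {ξ : Fin n → D} (hξ : LinearIndependent ℂ ξ) {W : Matrix (Fin n) (Fin n) ℂ}
    (hW : LinearIndependent ℂ W.row) :
    ∃ η : Fin n → D, LinearIndependent ℂ η ∧ ∀ i, ξ i = ∑ j, W j i • η j := by
  have hu : IsUnit W := Matrix.linearIndependent_rows_iff_isUnit.1 hW
  have hu' : IsUnit W.det := (Matrix.isUnit_iff_isUnit_det _).1 hu
  refine ⟨fun j => ∑ i, W⁻¹ i j • ξ i, ?_, fun i => ?_⟩
  · have h1 : LinearIndependent ℂ (W⁻¹).col :=
      Matrix.linearIndependent_cols_iff_isUnit.2 ((Matrix.isUnit_nonsing_inv_iff).2 hu)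
    exact h1.map' (Fintype.linearCombination ℂ ξ)
      (LinearMap.ker_eq_bot.2 (linearIndependent_iff_injective_fintypeLinearCombination.1 hξ))
  · simp only [Finset.smul_sum, smul_smul]
    rw [Finset.sum_comm]
    have h1 : ∀ k, ∑ j, W j i * W⁻¹ k j = (1 : Matrix (Fin n) (Fin n) ℂ) k i := fun k => by
      rw [← Matrix.nonsing_inv_mul W hu', Matrix.mul_apply]
      exact Finset.sum_congr rfl fun _ _ => mul_comm _ _
    simp only [← Finset.sum_smul, h1, Matrix.one_apply, ite_smul, one_smul, zero_smul,
      Finset.sum_ite_eq', Finset.mem_univ, if_true]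

lemma adjoin_eq_top_of_forall_eq_sum {D : Type*} [CommRing D] [Algebra ℂ D] {m n : ℕ}
    {W : Matrix (Fin m) (Fin n) ℂ} {η : Fin m → D} {ξ : Fin n → D}
    (h : ∀ i, ξ i = ∑ j, W j i • η j) (hξ : Algebra.adjoin ℂ (Set.range ξ) = ⊤) :
    Algebra.adjoin ℂ (Set.range η) = ⊤ := by
  rw [eq_top_iff, ← hξ, Algebra.adjoin_le_iff]
  rintro _ ⟨i, rfl⟩
  rw [h]
  exact sum_mem fun j _ => Subalgebra.smul_mem _ (Algebra.subset_adjoin (Set.mem_range_self j)) _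

lemma exists_linearIndependent_ker {n m r : ℕ} (h : m + r ≤ n)
    (φ : (Fin n → ℂ) →ₗ[ℂ] (Fin m → ℂ)) :
    ∃ v : Fin r → Fin n → ℂ, LinearIndependent ℂ v ∧ ∀ i, φ (v i) = 0 := by
  have h1 := φ.finrank_range_add_finrank_ker
  have h2 := Submodule.finrank_le (LinearMap.range φ)
  rw [Module.finrank_fintype_fun_eq_card, Fintype.card_fin] at h1 h2
  obtain ⟨v, hv⟩ := exists_linearIndependent_of_le_finrank (R := ℂ) (M := LinearMap.ker φ) (n := r)
    (by omega)
  exact ⟨fun i => v i, hv.map' (LinearMap.ker φ).subtype (LinearMap.ker φ).ker_subtype,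
    fun i => (v i).2⟩

lemma congr_apply {m n : ℕ} (B : Matrix (Fin n) (Fin n) ℂ) (W : Matrix (Fin m) (Fin n) ℂ)
    (i j : Fin m) : (W * B * W.transpose) i j = W i ⬝ᵥ B.mulVec (W j) := by
  have := dotProduct_congr_mulVec B W (Pi.single i 1) (Pi.single j 1)
  simp only [single_one_dotProduct, Matrix.mulVec_single_one, Matrix.single_one_vecMul] at this
  exact this

lemma isSymm_congr {m n : ℕ} {B : Matrix (Fin n) (Fin n) ℂ} (hB : B.IsSymm)
    (W : Matrix (Fin m) (Fin n) ℂ) : (W * B * W.transpose).IsSymm := by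
  rw [Matrix.IsSymm, Matrix.transpose_mul, Matrix.transpose_mul, Matrix.transpose_transpose, hB,
    Matrix.mul_assoc]

lemma congr_pencil {m : ℕ} (A : Fin 3 → Matrix (Fin 5) (Fin 5) ℂ) (s : Fin 3 → ℂ)
    (W : Matrix (Fin m) (Fin 5) ℂ) :
    W * pencil A s * W.transpose = ∑ k, s k • (W * A k * W.transpose) := by
  simp only [pencil, Matrix.mul_sum, Matrix.sum_mul, Matrix.mul_smul, Matrix.smul_mul]

/-- A threefold contained in the cone over the base locus of a stable net spans the whole space. -/
lemma MatStable.linearIndependent_of_trdeg_gt {A : Fin 3 → Matrix (Fin 5) (Fin 5) ℂ}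
    (hst : MatStable A) (hA : ∀ k, (A k).IsSymm) {D : Type} [CommRing D] [IsDomain D] [Algebra ℂ D]
    {ξ : Fin 5 → D} (hξ : Algebra.adjoin ℂ (Set.range ξ) = ⊤) (htr : 2 < Algebra.trdeg ℂ D)
    (h0 : ∀ k, aeval ξ (quadPoly (A k)) = 0) : LinearIndependent ℂ ξ := by
  by_contra hli
  obtain ⟨d, η, W, hd, hη, hW, hηξ⟩ := exists_linearIndependent_generators ξ
  rw [linearIndependent_iff_card_le_finrank_span, ← hd, Fintype.card_fin] at hli
  have hsymm : ∀ k, (W * A k * W.transpose).IsSymm := fun k => isSymm_congr (hA k) W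
  have hη0 : ∀ k, aeval η (quadPoly (W * A k * W.transpose)) = 0 := fun k => by
    rw [aeval_quadPoly_congr _ _ hηξ, h0]
  have halg := isAlgebraic_of_adjoin_eq_top (adjoin_eq_top_of_forall_eq_sum hηξ hξ)
  have hd3 : 3 ≤ d := by
    by_contra! hd2
    refine htr.not_ge ((Algebra.IsAlgebraic.trdeg_le_cardinalMk ℂ (Set.range η)).trans
      (Cardinal.mk_range_le.trans ?_))
    rw [Cardinal.mk_fin]
    exact_mod_cast (by omega : d ≤ 2)
  clear hd
  obtain rfl | rfl : d = 3 ∨ d = 4 := by omega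
  · have hb := Algebra.IsAlgebraic.isTranscendenceBasis_of_le_trdeg_of_finite (R := ℂ) η (by
      rw [Cardinal.mk_fin]
      exact natCast_succ_le_of_lt (n := 2) (by simpa using htr))
    have hz : ∀ k, W * A k * W.transpose = 0 := fun k =>
      quadPoly_injective_of_isSymm (hsymm k) (hb.1 (by rw [hη0, map_zero]))
    refine hst.not_vanish_plane W.row hW fun s i j => ?_
    change W i ⬝ᵥ (pencil A s).mulVec (W j) = 0
    rw [← congr_apply, congr_pencil]
    simp [hz]
  · obtain ⟨c, B, hcB⟩ : ∃ (c : Fin 3 → ℂ) (B : Matrix (Fin 4) (Fin 4) ℂ),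
        ∀ k, W * A k * W.transpose = c k • B := by
      by_cases hz : ∀ k, W * A k * W.transpose = 0
      · exact ⟨0, 0, by simpa using hz⟩
      push Not at hz
      obtain ⟨l, hl⟩ := hz
      have hl' : quadPoly (W * A l * W.transpose) ≠ 0 := fun h =>
        hl (quadPoly_injective_of_isSymm (hsymm l) h)
      have hdvd : ∀ k, ∃ c : ℂ, W * A k * W.transpose = c • (W * A l * W.transpose) := by
        intro k
        obtain ⟨g, hg⟩ := dvd_of_aeval_eq_zero hη htr (quadPoly_isHomogeneous _) hl' (hη0 l) (hη0 k)
        have hgh : g.IsHomogeneous 0 := isHomogeneous_of_mul_right (quadPoly_isHomogeneous _)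
          (by rw [← hg]; exact quadPoly_isHomogeneous _) hl'
        obtain ⟨c, rfl⟩ : ∃ c, g = C c :=
          ⟨_, totalDegree_eq_zero_iff_eq_C.1 ((totalDegree_zero_iff_isHomogeneous _).2 hgh)⟩
        refine ⟨c, sub_eq_zero.1
          (quadPoly_injective_of_isSymm ((hsymm k).sub ((hsymm l).smul c)) ?_)⟩
        rw [sub_eq_add_neg, ← neg_smul, quadPoly_add, quadPoly_smul, hg, neg_smul, smul_eq_C_mul]
        ring
      choose c hc using hdvd
      exact ⟨c, _, hc⟩
    obtain ⟨s, hs, hs0⟩ := exists_linearIndependent_ker (n := 3) (m := 1) (r := 2) le_rfl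
      (LinearMap.pi fun _ => Fintype.linearCombination ℂ c)
    refine hst.not_vanish_hyperplane W.row hW s hs fun k i j => ?_
    change W i ⬝ᵥ (pencil A (s k)).mulVec (W j) = 0
    have h1 := congrFun (hs0 k) 0
    simp only [LinearMap.pi_apply, Fintype.linearCombination_apply, Pi.zero_apply] at h1
    rw [← congr_apply, congr_pencil]
    simp only [hcB, smul_smul, ← Finset.sum_smul]
    simp only [smul_eq_mul] at h1
    rw [h1, zero_smul, Matrix.zero_apply]

lemma MatStable.pencil_ne_zero {A : Fin 3 → Matrix (Fin 5) (Fin 5) ℂ} (hst : MatStable A)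
    {s : Fin 3 → ℂ} (hs : s ≠ 0) : pencil A s ≠ 0 := by
  intro h
  obtain ⟨t, ht, hts⟩ := exists_linearIndependent_extension (n := 3) (m := 1) (by norm_num)
    (fun _ => s) (LinearIndependent.of_subsingleton 0 hs)
  obtain ⟨k, i, j, hlt, hne⟩ := hst t ht _ (Pi.basisFun ℂ (Fin 5)).linearIndependent
    ![1,0,0,0,-1] ![-5,2,2] ⟨by decide, by decide, by decide⟩ (by decide)
  have key : ∀ (k : Fin 3) (i j : Fin 5), (![-5,2,2] : Fin 3 → ℤ) k <
      (![1,0,0,0,-1] : Fin 5 → ℤ) i + (![1,0,0,0,-1] : Fin 5 → ℤ) j → k = 0 := by decide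
  obtain rfl := key k i j hlt
  have hk' : t 0 = s := hts 0
  rw [hk', h, Matrix.zero_mulVec, dotProduct_zero] at hne
  exact hne rfl

/-- The linear form with given coefficients. -/
noncomputable def linForm {n : ℕ} (c : Fin n → ℂ) : MvPolynomial (Fin n) ℂ := ∑ i, c i • X i

lemma aeval_linForm {D : Type*} [CommRing D] [Algebra ℂ D] {n : ℕ} (c : Fin n → ℂ) (x : Fin n → D) :
    aeval x (linForm c) = ∑ i, c i • x i := by
  simp [linForm]

lemma eval_linForm {n : ℕ} (c x : Fin n → ℂ) : eval x (linForm c) = c ⬝ᵥ x := by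
  rw [← MvPolynomial.coe_aeval_eq_eval, RingHom.coe_coe, aeval_linForm]
  rfl

lemma linForm_isHomogeneous {n : ℕ} (c : Fin n → ℂ) : (linForm c).IsHomogeneous 1 :=
  IsHomogeneous.sum _ _ _ fun i _ => by
    rw [smul_eq_C_mul]
    exact (isHomogeneous_X ℂ i).C_mul _

lemma exists_eq_linForm {n : ℕ} {f : MvPolynomial (Fin n) ℂ} (hf : f.IsHomogeneous 1) :
    ∃ c, f = linForm c := by
  rw [← mem_homogeneousSubmodule, homogeneousSubmodule_one_eq_span_X,
    Submodule.mem_span_range_iff_exists_fun] at hf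
  obtain ⟨c, rfl⟩ := hf
  exact ⟨c, rfl⟩

lemma linForm_eq_zero {n : ℕ} {c : Fin n → ℂ} (h : linForm c = 0) : c = 0 := by
  funext i
  have := eval_linForm c (Pi.single i 1)
  rw [h, map_zero, dotProduct_single_one] at this
  exact this.symm

lemma eq_zero_of_aeval_linForm {D : Type*} [CommRing D] [Algebra ℂ D] {n : ℕ} {η : Fin n → D}
    (hη : LinearIndependent ℂ η) {c : Fin n → ℂ} (h : aeval η (linForm c) = 0) : c = 0 := by
  rw [aeval_linForm] at h
  exact funext (Fintype.linearIndependent_iff.1 hη c h)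

lemma linForm_add_smul {n : ℕ} (a b : ℂ) (c d : Fin n → ℂ) :
    linForm (a • c + b • d) = C a * linForm c + C b * linForm d := by
  simp only [linForm, Pi.add_apply, Pi.smul_apply, add_smul, Finset.sum_add_distrib,
    Finset.mul_sum, smul_eq_mul, ← smul_smul, smul_eq_C_mul]

lemma prime_linForm {n : ℕ} {c : Fin n → ℂ} (hc : c ≠ 0) : Prime (linForm c) := by
  have h0 : linForm c ≠ 0 := fun h => hc (linForm_eq_zero h)
  have hd := (linForm_isHomogeneous c).totalDegree h0
  refine Irreducible.prime ⟨fun hu => ?_, fun f g hfg => ?_⟩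
  · have := (isUnit_iff_totalDegree_of_isReduced.1 hu).2
    omega
  · rw [hfg] at h0 hd
    have hf := left_ne_zero_of_mul h0
    have hg := right_ne_zero_of_mul h0
    rw [totalDegree_mul_of_isDomain hf hg] at hd
    rcases Nat.eq_zero_or_pos f.totalDegree with h | h
    · exact Or.inl (isUnit_of_totalDegree_eq_zero hf h)
    · exact Or.inr (isUnit_of_totalDegree_eq_zero hg (by omega))

lemma linForm_dvd_linForm {n : ℕ} {c d : Fin n → ℂ} (hc : c ≠ 0) (h : linForm c ∣ linForm d) :
    ∃ a : ℂ, d = a • c := by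
  obtain ⟨g, hg⟩ := h
  have h0 : linForm c ≠ 0 := fun h => hc (linForm_eq_zero h)
  have hgh : g.IsHomogeneous 0 := isHomogeneous_of_mul_right (linForm_isHomogeneous c)
    (by rw [← hg]; exact linForm_isHomogeneous d) h0
  obtain ⟨a, rfl⟩ : ∃ a, g = C a :=
    ⟨_, totalDegree_eq_zero_iff_eq_C.1 ((totalDegree_zero_iff_isHomogeneous _).2 hgh)⟩
  refine ⟨a, ?_⟩
  have h1 := linForm_add_smul 1 (-a) d c
  rw [hg, C_neg, C_1] at h1
  have h2 : linForm ((1 : ℂ) • d + (-a) • c) = 0 := by rw [h1]; ring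
  have h3 := linForm_eq_zero h2
  rwa [one_smul, neg_smul, ← sub_eq_add_neg, sub_eq_zero] at h3

lemma aeval_quadPoly_succ {D : Type*} [CommRing D] [Algebra ℂ D] {n : ℕ}
    {B : Matrix (Fin (n + 1)) (Fin (n + 1)) ℂ} (hB : B.IsSymm) (h0 : B 0 0 = 0)
    (x : Fin (n + 1) → D) :
    aeval x (quadPoly B) = x 0 * aeval (x ∘ Fin.succ) (linForm fun j => 2 * B 0 j.succ) +
      aeval (x ∘ Fin.succ) (quadPoly (B.submatrix Fin.succ Fin.succ)) := by
  rw [aeval_quadPoly, aeval_quadPoly, aeval_linForm, Fin.sum_univ_succ, Fin.sum_univ_succ]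
  simp only [Fin.sum_univ_succ (fun j => algebraMap ℂ D (B _ j) * _), h0, map_zero, zero_mul,
    zero_add, Finset.sum_add_distrib, Function.comp_apply, Matrix.submatrix_apply, ← add_assoc,
    Finset.mul_sum, ← hB.apply 0 (Fin.succ _)]
  congr 1
  rw [← Finset.sum_add_distrib]
  refine Finset.sum_congr rfl fun i _ => ?_
  rw [Algebra.smul_def, map_mul, map_ofNat]
  ring

lemma isAlgebraic_adjoin_tail {D : Type*} [CommRing D] [IsDomain D] [Algebra ℂ D] {n : ℕ}
    {η : Fin (n + 1) → D} (hη : Algebra.adjoin ℂ (Set.range η) = ⊤) {a b : D}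
    (ha : a ∈ Algebra.adjoin ℂ (Set.range (η ∘ Fin.succ)))
    (hb : b ∈ Algebra.adjoin ℂ (Set.range (η ∘ Fin.succ))) (ha0 : a ≠ 0)
    (h : η 0 * a + b = 0) :
    Algebra.IsAlgebraic (Algebra.adjoin ℂ (Set.range (η ∘ Fin.succ))) D := by
  set R := Algebra.adjoin ℂ (Set.range (η ∘ Fin.succ)) with hR
  have h0 : IsAlgebraic R (η 0) := by
    refine ⟨Polynomial.C ⟨a, ha⟩ * Polynomial.X + Polynomial.C ⟨b, hb⟩, fun hp => ha0 ?_, ?_⟩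
    · have := congrArg (fun p => Polynomial.coeff p 1) hp
      have h1 : (⟨a, ha⟩ : R) = 0 := by simpa [Polynomial.coeff_C] using this
      exact congrArg Subtype.val h1
    · simp only [map_add, map_mul, Polynomial.aeval_C, Polynomial.aeval_X]
      rw [mul_comm]
      exact h
  have hle : (⊤ : Subalgebra ℂ D) ≤ (Subalgebra.algebraicClosure R D).restrictScalars ℂ := by
    rw [← hη, Algebra.adjoin_le_iff]
    rintro _ ⟨i, rfl⟩
    refine Fin.cases h0 (fun j => ?_) i
    exact isAlgebraic_algebraMap (⟨η j.succ, Algebra.subset_adjoin (Set.mem_range_self j)⟩ : R)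
  exact ⟨fun x => hle (Algebra.mem_top : x ∈ _)⟩

lemma cons_zero_dotProduct {n : ℕ} (c : Fin n → ℂ) (x : Fin (n + 1) → ℂ) :
    (Fin.cons 0 c : Fin (n + 1) → ℂ) ⬝ᵥ x = c ⬝ᵥ (x ∘ Fin.succ) := by
  simp [dotProduct, Fin.sum_univ_succ]

lemma MatStable.linearIndependent_row_zero {A : Fin 3 → Matrix (Fin 5) (Fin 5) ℂ}
    (hst : MatStable A) (hA : ∀ k, (A k).IsSymm) (hrow : ∀ j, A 0 0 j = 0)
    (hbase : ∀ k, A k 0 0 = 0) :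
    LinearIndependent ℂ
      ![fun j : Fin 4 => 2 * A 1 0 j.succ, fun j : Fin 4 => 2 * A 2 0 j.succ] := by
  rw [LinearIndependent.pair_iff]
  intro c d h
  by_contra hcd
  have hp : ∀ r i, (pencil A r).mulVec (Pi.single 0 1) i = ∑ k, r k * A k 0 i := by
    intro r i
    have : (pencil A r).mulVec (Pi.single 0 1) i = pencil A r i 0 := by simp
    rw [this, ← (pencil_isSymm hA r).apply, pencil]
    simp [Matrix.sum_apply]
  refine hst.not_singular_pencil hA (Pi.single 0 1) (by simp) ![![1, 0, 0], ![0, c, d]] ?_ ?_ ?_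
  · rw [LinearIndependent.pair_iff]
    intro a b hab
    have h0 := congrFun hab 0
    have h1 := congrFun hab 1
    have h2 := congrFun hab 2
    simp only [Pi.add_apply, Pi.smul_apply, smul_eq_mul, Pi.zero_apply, Matrix.cons_val_zero,
      Matrix.cons_val_one, Matrix.cons_val, mul_one, mul_zero, zero_add, add_zero] at h0 h1 h2
    refine ⟨h0, ?_⟩
    by_contra hb
    exact hcd ⟨(mul_eq_zero.1 h1).resolve_left hb, (mul_eq_zero.1 h2).resolve_left hb⟩
  · intro i
    funext j
    rw [hp]
    fin_cases i
    · simp [Fin.sum_univ_three, hrow]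
    · refine Fin.cases ?_ (fun j => ?_) j
      · simp [hbase]
      · have := congrFun h j
        simp only [Pi.add_apply, Pi.smul_apply, smul_eq_mul, Pi.zero_apply] at this
        simp only [Fin.sum_univ_three, Pi.zero_apply]
        simp
        linear_combination this / 2
  · intro r
    rw [single_dotProduct, one_mul, hp]
    simp [hbase]

/-- A net whose quadrics all pass through a point at which one of them is singular has a linear
syzygy, if its zero locus is too big. -/
lemma MatStable.exists_linear_syzygy {A : Fin 3 → Matrix (Fin 5) (Fin 5) ℂ}
    (hst : MatStable A) (hA : ∀ k, (A k).IsSymm) (hrow : ∀ j, A 0 0 j = 0)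
    (hbase : ∀ k, A k 0 0 = 0)
    {D : Type} [CommRing D] [IsDomain D] [Algebra ℂ D] {η : Fin 5 → D}
    (hη : Algebra.adjoin ℂ (Set.range η) = ⊤) (hli : LinearIndependent ℂ η)
    (htr : 2 < Algebra.trdeg ℂ D) (h0 : ∀ k, aeval η (quadPoly (A k)) = 0) :
    ∃ n : Fin 3 → Fin 5 → ℂ, LinearIndependent ℂ n ∧
      ∀ x, ∑ k, (n k ⬝ᵥ x) * (x ⬝ᵥ (A k).mulVec x) = 0 := by
  have hlam := hst.linearIndependent_row_zero hA hrow hbase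
  set lam : Fin 3 → Fin 4 → ℂ := fun k j => 2 * A k 0 j.succ with hlamdef
  change LinearIndependent ℂ ![lam 1, lam 2] at hlam
  set q : Fin 3 → MvPolynomial (Fin 4) ℂ :=
    fun k => quadPoly ((A k).submatrix Fin.succ Fin.succ) with hq
  have hlam1 : lam 1 ≠ 0 := hlam.ne_zero 0
  have hlam0 : lam 0 = 0 := by funext j; simp [hlamdef, hrow]
  have hlin0 : linForm (lam 0) = 0 := by simp [hlam0, linForm]
  have hqh : ∀ k, (q k).IsHomogeneous 2 := fun k => quadPoly_isHomogeneous _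
  have hq0 : q 0 ≠ 0 := by
    intro h
    have h1 := quadPoly_injective_of_isSymm ((hA 0).submatrix Fin.succ) h
    refine hst.pencil_ne_zero (s := Pi.single 0 1) (by simp) ?_
    have : pencil A (Pi.single 0 1) = A 0 := by simp [pencil]
    rw [this]
    ext i j
    refine Fin.cases (hrow j) (fun i => ?_) i
    refine Fin.cases ?_ (fun j => ?_) j
    · rw [← (hA 0).apply]; exact hrow _
    · exact congrFun (congrFun h1 i) j
  have hev : ∀ k, η 0 * aeval (η ∘ Fin.succ) (linForm (lam k)) + aeval (η ∘ Fin.succ) (q k) = 0 :=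
    fun k => (aeval_quadPoly_succ (hA k) (hbase k) η).symm.trans (h0 k)
  have hli' : LinearIndependent ℂ (η ∘ Fin.succ) := hli.comp _ (Fin.succ_injective _)
  have hmem : ∀ f : MvPolynomial (Fin 4) ℂ,
      aeval (η ∘ Fin.succ) f ∈ Algebra.adjoin ℂ (Set.range (η ∘ Fin.succ)) := by
    intro f
    rw [Algebra.adjoin_range_eq_range_aeval]
    exact ⟨f, rfl⟩
  have halg := isAlgebraic_adjoin_tail hη (hmem (linForm (lam 1))) (hmem (q 1))
    (fun h => hlam1 (eq_zero_of_aeval_linForm hli' h)) (hev 1)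
  have hdvd : q 0 ∣ linForm (lam 2) * q 1 - linForm (lam 1) * q 2 := by
    refine dvd_of_aeval_eq_zero hli' htr (hqh 0) hq0 ?_ ?_
    · have := hev 0
      rwa [hlin0, map_zero, mul_zero, zero_add] at this
    · rw [map_sub, map_mul, map_mul]
      linear_combination aeval (η ∘ Fin.succ) (linForm (lam 2)) * hev 1 -
        aeval (η ∘ Fin.succ) (linForm (lam 1)) * hev 2
  obtain ⟨m, hm⟩ := hdvd
  have hmh : m.IsHomogeneous 1 := by
    refine isHomogeneous_of_mul_right (hqh 0) (b := 1) ?_ hq0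
    rw [← hm]
    have h3 : 2 + 1 = 1 + 2 := rfl
    rw [h3]
    exact ((linForm_isHomogeneous _).mul (hqh 1)).sub ((linForm_isHomogeneous _).mul (hqh 2))
  obtain ⟨μ, rfl⟩ := exists_eq_linForm hmh
  refine ⟨![Fin.cons 0 (-μ), Fin.cons 0 (lam 2), Fin.cons 0 (-lam 1)], ?_, fun x => ?_⟩
  · rw [Fintype.linearIndependent_iff]
    intro g hg
    have hg' : g 0 • μ = g 1 • lam 2 - g 2 • lam 1 := by
      funext j
      have := congrFun hg j.succ
      simp [Fin.sum_univ_three] at this ⊢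
      linear_combination -this
    by_cases hg0 : g 0 = 0
    · have h1 : (-g 2) • lam 1 + g 1 • lam 2 = 0 := by
        rw [hg0, zero_smul] at hg'
        rw [hg']; module
      obtain ⟨h2, h3⟩ := LinearIndependent.pair_iff.1 hlam _ _ h1
      intro i
      fin_cases i
      · exact hg0
      · exact h3
      · exact neg_eq_zero.1 h2
    · exfalso
      have hμ : μ = (-g 2 / g 0) • lam 1 + (g 1 / g 0) • lam 2 := by
        have : μ = (g 0)⁻¹ • (g 0 • μ) := by rw [smul_smul, inv_mul_cancel₀ hg0, one_smul]
        rw [this, hg']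
        module
      set α := -g 2 / g 0
      set β := g 1 / g 0
      rw [hμ, linForm_add_smul] at hm
      have hdv : linForm (lam 1) ∣ linForm (lam 2) * (q 1 - C β * q 0) :=
        ⟨q 2 + C α * q 0, by linear_combination hm⟩
      obtain ⟨k, hk⟩ := ((prime_linForm hlam1).dvd_or_dvd hdv).resolve_left fun h => by
        obtain ⟨a, ha⟩ := linForm_dvd_linForm hlam1 h
        have := LinearIndependent.pair_iff.1 hlam a (-1) (by rw [ha]; module)
        exact absurd this.2 (by norm_num)
      have hkh : k.IsHomogeneous 1 := by
        refine isHomogeneous_of_mul_right (linForm_isHomogeneous (lam 1)) (b := 1) ?_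
          (prime_linForm hlam1).ne_zero
        rw [← hk]
        have hc := (isHomogeneous_C (Fin 4) β).mul (hqh 0)
        rw [zero_add] at hc
        exact (hqh 1).sub hc
      obtain ⟨κ, rfl⟩ := exists_eq_linForm hkh
      have e := congrArg (aeval (η ∘ Fin.succ)) hk
      have e0 := hev 0
      rw [hlin0, map_zero, mul_zero, zero_add] at e0
      rw [map_sub, map_mul, map_mul, e0, mul_zero, sub_zero] at e
      have e1 : aeval (η ∘ Fin.succ) (linForm (lam 1)) *
          (η 0 + aeval (η ∘ Fin.succ) (linForm κ)) = 0 := by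
        linear_combination hev 1 - e
      rcases mul_eq_zero.1 e1 with h | h
      · exact hlam1 (eq_zero_of_aeval_linForm hli' h)
      · have hc := eq_zero_of_aeval_linForm (c := Fin.cons 1 κ) hli
          (by rw [aeval_linForm, Fin.sum_univ_succ]
              rw [aeval_linForm] at h
              simpa using h)
        exact one_ne_zero (congrFun hc 0)
  · have hx : ∀ k, x ⬝ᵥ (A k).mulVec x =
        x 0 * eval (x ∘ Fin.succ) (linForm (lam k)) + eval (x ∘ Fin.succ) (q k) := by
      intro k
      rw [← eval_quadPoly, ← coe_aeval_eq_eval, ← coe_aeval_eq_eval]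
      exact aeval_quadPoly_succ (hA k) (hbase k) x
    have e := congrArg (eval (x ∘ Fin.succ)) hm
    simp only [map_sub, map_mul, eval_linForm] at e
    have hl0 : lam 0 ⬝ᵥ x ∘ Fin.succ = 0 := by rw [hlam0, zero_dotProduct]
    simp only [Fin.sum_univ_three, hx, Matrix.cons_val_zero, Matrix.cons_val_one, Matrix.cons_val,
      cons_zero_dotProduct, neg_dotProduct, eval_linForm]
    linear_combination e - (μ ⬝ᵥ x ∘ Fin.succ) * x 0 * hl0

open scoped Matrix in
/-- The Koszul complex on the first three coordinates is exact in degree two. -/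
lemma exists_eq_cross_of_coordinate_syzygy {B : Fin 3 → Matrix (Fin 5) (Fin 5) ℂ}
    (hB : ∀ k, (B k).IsSymm)
    (hsyz : ∀ y : Fin 5 → ℂ, ∑ k : Fin 3, y (Fin.castLE (by norm_num) k) *
      (y ⬝ᵥ (B k).mulVec y) = 0) :
    ∃ U : Matrix (Fin 3) (Fin 5) ℂ, ∀ y : Fin 5 → ℂ, (fun k => y ⬝ᵥ (B k).mulVec y) =
      (fun k : Fin 3 => y (Fin.castLE (by norm_num) k)) ⨯₃ U.mulVec y := by
  have hs : ∀ k i j, B k j i = B k i j := fun k i j => (hB k).apply i j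
  set δ : Fin 3 → Fin 5 → ℂ := fun k i => if i = Fin.castLE (by norm_num) k then 1 else 0
  have hrel : ∀ i j l : Fin 5, ∑ k : Fin 3, (δ k i * B k j l + δ k j * B k i l +
      δ k l * B k i j) = 0 := by
    intro i j l
    let e : Fin 5 → Fin 5 → ℂ := fun i => Pi.single i 1
    have hexp : ∀ k (x y : Fin 5 → ℂ), (x + y) ⬝ᵥ (B k).mulVec (x + y) =
        x ⬝ᵥ (B k).mulVec x + 2 * (x ⬝ᵥ (B k).mulVec y) + y ⬝ᵥ (B k).mulVec y := by
      intro k x y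
      rw [Matrix.mulVec_add, add_dotProduct, dotProduct_add, dotProduct_add,
        dotProduct_mulVec_comm (hB k) y x]
      ring
    have hent : ∀ k i j, e i ⬝ᵥ (B k).mulVec (e j) = B k i j := by
      intro k i j; simp [e]
    have hδ : ∀ (k : Fin 3) (i : Fin 5), e i (Fin.castLE (by norm_num) k) = δ k i := by
      intro k i
      simp only [e, δ, Pi.single_apply, eq_comm]
    have h1 := hsyz (e i + e j + e l)
    have h2 := hsyz (e i + e j)
    have h3 := hsyz (e i + e l)
    have h4 := hsyz (e j + e l)
    have h5 := hsyz (e i)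
    have h6 := hsyz (e j)
    have h7 := hsyz (e l)
    simp only [hexp, add_dotProduct, hent, Pi.add_apply, hδ, Fin.sum_univ_three] at *
    linear_combination (h1 - h2 - h3 - h4 + h5 + h6 + h7) / 2
  have r : ∀ i j l : Fin 5, δ 0 i * B 0 j l + δ 0 j * B 0 i l + δ 0 l * B 0 i j +
      (δ 1 i * B 1 j l + δ 1 j * B 1 i l + δ 1 l * B 1 i j) +
      (δ 2 i * B 2 j l + δ 2 j * B 2 i l + δ 2 l * B 2 i j) = 0 := fun i j l => by
    simpa [Fin.sum_univ_three] using hrel i j l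
  simp only [δ, show Fin.castLE (by norm_num : 3 ≤ 5) 0 = 0 from rfl,
    show Fin.castLE (by norm_num : 3 ≤ 5) 1 = 1 from rfl,
    show Fin.castLE (by norm_num : 3 ≤ 5) 2 = 2 from rfl] at r
  have r000 : B 0 0 0 = 0 := by grind [r 0 0 0]
  have r111 : B 1 1 1 = 0 := by grind [r 1 1 1]
  have r222 : B 2 2 2 = 0 := by grind [r 2 2 2]
  have r003 : B 0 0 3 = 0 := by grind [r 0 0 3]
  have r004 : B 0 0 4 = 0 := by grind [r 0 0 4]
  have r113 : B 1 1 3 = 0 := by grind [r 1 1 3]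
  have r114 : B 1 1 4 = 0 := by grind [r 1 1 4]
  have r223 : B 2 2 3 = 0 := by grind [r 2 2 3]
  have r224 : B 2 2 4 = 0 := by grind [r 2 2 4]
  have r033 : B 0 3 3 = 0 := by grind [r 0 3 3]
  have r034 : B 0 3 4 = 0 := by grind [r 0 3 4]
  have r044 : B 0 4 4 = 0 := by grind [r 0 4 4]
  have r133 : B 1 3 3 = 0 := by grind [r 1 3 3]
  have r134 : B 1 3 4 = 0 := by grind [r 1 3 4]
  have r144 : B 1 4 4 = 0 := by grind [r 1 4 4]
  have r233 : B 2 3 3 = 0 := by grind [r 2 3 3]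
  have r234 : B 2 3 4 = 0 := by grind [r 2 3 4]
  have r244 : B 2 4 4 = 0 := by grind [r 2 4 4]
  have r013 : B 1 0 3 = -B 0 1 3 := by grind [r 0 1 3]
  have r123 : B 2 1 3 = -B 1 2 3 := by grind [r 1 2 3]
  have r023 : B 0 2 3 = -B 2 0 3 := by grind [r 0 2 3]
  have r014 : B 1 0 4 = -B 0 1 4 := by grind [r 0 1 4]
  have r124 : B 2 1 4 = -B 1 2 4 := by grind [r 1 2 4]
  have r024 : B 0 2 4 = -B 2 0 4 := by grind [r 0 2 4]
  have r001 : B 0 0 1 = -B 1 0 0 / 2 := by grind [r 0 0 1]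
  have r002 : B 0 0 2 = -B 2 0 0 / 2 := by grind [r 0 0 2]
  have r011 : B 1 0 1 = -B 0 1 1 / 2 := by grind [r 0 1 1]
  have r112 : B 1 1 2 = -B 2 1 1 / 2 := by grind [r 1 1 2]
  have r022 : B 2 0 2 = -B 0 2 2 / 2 := by grind [r 0 2 2]
  have r122 : B 2 1 2 = -B 1 2 2 / 2 := by grind [r 1 2 2]
  have r012 : B 0 1 2 = -B 1 0 2 - B 2 0 1 := by grind [r 0 1 2]
  refine ⟨![![0, -B 2 1 1, B 1 2 2, 2 * B 1 2 3, 2 * B 1 2 4],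
    ![B 2 0 0, 2 * B 2 0 1, -B 0 2 2, 2 * B 2 0 3, 2 * B 2 0 4],
    ![-B 1 0 0, B 0 1 1, -2 * B 1 0 2, 2 * B 0 1 3, 2 * B 0 1 4]], fun y => ?_⟩
  have hsym : ∀ k, B k 1 0 = B k 0 1 ∧ B k 2 0 = B k 0 2 ∧ B k 3 0 = B k 0 3 ∧ B k 4 0 = B k 0 4 ∧
    B k 2 1 = B k 1 2 ∧ B k 3 1 = B k 1 3 ∧ B k 4 1 = B k 1 4 ∧ B k 3 2 = B k 2 3 ∧
    B k 4 2 = B k 2 4 ∧ B k 4 3 = B k 3 4 := fun k => by simp only [hs, and_self]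
  funext k
  rw [cross_apply]
  fin_cases k <;>
  · simp [Matrix.mulVec, dotProduct, Fin.sum_univ_five, hsym, r000, r111, r222, r003, r004,
      r113, r114, r223, r224, r033, r034, r044, r133, r134, r144, r233, r234, r244, r013,
      r123, r023, r014, r124, r024, r001, r002, r011, r112, r022, r122, r012]
    ring

section

open scoped Matrix

lemma cross_eq_zero_of_dotProduct_eq_zero {α β a b : Fin 3 → ℂ}
    (hαβ : LinearIndependent ℂ ![α, β]) (h1 : α ⬝ᵥ a = 0) (h2 : β ⬝ᵥ a = 0) (h3 : α ⬝ᵥ b = 0)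
    (h4 : β ⬝ᵥ b = 0) : a ⨯₃ b = 0 := by
  set c := α ⨯₃ β with hc
  have hc0 : c ≠ 0 := crossProduct_ne_zero_iff_linearIndependent.2 hαβ
  have key : ∀ x : Fin 3 → ℂ, α ⬝ᵥ x = 0 → β ⬝ᵥ x = 0 → ∀ i j, x i * c j = x j * c i := by
    intro x hx hy i j
    rw [Matrix.vec3_dotProduct] at hx hy
    fin_cases i <;> fin_cases j <;> simp [hc, cross_apply] <;> grind
  obtain ⟨i, hi⟩ := Function.ne_iff.1 hc0
  have hmin : ∀ j k, a j * b k = a k * b j := by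
    intro j k
    refine mul_left_cancel₀ (mul_ne_zero hi hi) ?_
    have e1 := key a h1 h2
    have e2 := key b h3 h4
    linear_combination c i * b k * e1 j i + a i * c j * e2 k i - c i * b j * e1 k i
      - a i * c k * e2 j i
  rw [cross_apply]
  funext k
  fin_cases k <;> simp [hmin]

lemma exists_eq_cross_of_syzygy {A : Fin 3 → Matrix (Fin 5) (Fin 5) ℂ}
    (hA : ∀ k, (A k).IsSymm) {n : Matrix (Fin 3) (Fin 5) ℂ} (hn : LinearIndependent ℂ n.row)
    (hsyz : ∀ x, ∑ k, (n k ⬝ᵥ x) * (x ⬝ᵥ (A k).mulVec x) = 0) :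
    ∃ u : Matrix (Fin 3) (Fin 5) ℂ, ∀ r x, x ⬝ᵥ (pencil A r).mulVec x =
      r ⬝ᵥ n.mulVec x ⨯₃ u.mulVec x := by
  obtain ⟨w, hw, hwn⟩ := exists_linearIndependent_extension (by norm_num) n hn
  set N : Matrix (Fin 5) (Fin 5) ℂ := Matrix.of w with hN
  have hNu : IsUnit N := Matrix.linearIndependent_rows_iff_isUnit.1 hw
  have hdet := (Matrix.isUnit_iff_isUnit_det N).1 hNu
  have hq : ∀ k y, y ⬝ᵥ ((N⁻¹).transpose * A k * (N⁻¹).transpose.transpose).mulVec y =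
      N⁻¹.mulVec y ⬝ᵥ (A k).mulVec (N⁻¹.mulVec y) := by
    intro k y
    rw [dotProduct_congr_mulVec, Matrix.vecMul_transpose]
  have hcoord : ∀ y k, n k ⬝ᵥ N⁻¹.mulVec y = y (Fin.castLE (by norm_num) k) := by
    intro y k
    rw [← hwn k]
    change N.mulVec (N⁻¹.mulVec y) _ = _
    rw [Matrix.mulVec_mulVec, Matrix.mul_nonsing_inv _ hdet, Matrix.one_mulVec]
  obtain ⟨U, hU⟩ := exists_eq_cross_of_coordinate_syzygy
    (B := fun k => (N⁻¹).transpose * A k * (N⁻¹).transpose.transpose)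
    (fun k => isSymm_congr (hA k) _) fun y => by
      simp only [hq]
      simpa only [hcoord] using hsyz (N⁻¹.mulVec y)
  refine ⟨U * N, fun r x => ?_⟩
  have h := hU (N.mulVec x)
  simp only [hq, ← hcoord] at h
  have hx : N⁻¹.mulVec (N.mulVec x) = x := by
    rw [Matrix.mulVec_mulVec, Matrix.nonsing_inv_mul _ hdet, Matrix.one_mulVec]
  rw [hx, Matrix.mulVec_mulVec] at h
  change _ = n.mulVec x ⨯₃ _ at h
  rw [← h]
  rw [pencil, Matrix.sum_mulVec, dotProduct_sum]
  simp only [Matrix.smul_mulVec, dotProduct_smul]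
  rfl

lemma mulVec_eq_zero_of_add {n : ℕ} {B : Matrix (Fin n) (Fin n) ℂ} (hB : B.IsSymm)
    {v : Fin n → ℂ} (h : ∀ y, (y + v) ⬝ᵥ B.mulVec (y + v) = y ⬝ᵥ B.mulVec y) :
    B.mulVec v = 0 := by
  have h0 : v ⬝ᵥ B.mulVec v = 0 := by simpa using h 0
  refine dotProduct_eq_zero _ fun y => ?_
  have := h y
  rw [Matrix.mulVec_add, add_dotProduct, dotProduct_add, dotProduct_add,
    dotProduct_mulVec_comm hB v y, h0] at this
  rw [dotProduct_comm]
  linear_combination this / 2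

lemma MatStable.false_of_linear_syzygy {A : Fin 3 → Matrix (Fin 5) (Fin 5) ℂ}
    (hst : MatStable A) (hA : ∀ k, (A k).IsSymm)
    {D : Type*} [CommRing D] [IsDomain D] [Algebra ℂ D] {η : Fin 5 → D}
    (hli : LinearIndependent ℂ η) (h0 : ∀ k, aeval η (quadPoly (A k)) = 0)
    {n : Matrix (Fin 3) (Fin 5) ℂ} (hn : LinearIndependent ℂ n.row)
    (hsyz : ∀ x, ∑ k, (n k ⬝ᵥ x) * (x ⬝ᵥ (A k).mulVec x) = 0) : False := by
  obtain ⟨u, hu⟩ := exists_eq_cross_of_syzygy hA hn hsyz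
  obtain ⟨α, β, hβ, hrel⟩ : ∃ α β : Fin 3 → ℂ, β ≠ 0 ∧
      ∀ x, α ⬝ᵥ n.mulVec x + β ⬝ᵥ u.mulVec x = 0 := by
    have := LinearMap.ker_ne_bot_of_finrank_lt
      (f := n.vecMulLinear.coprod u.vecMulLinear) (by simp)
    obtain ⟨⟨α, β⟩, hm, hne⟩ := Submodule.exists_mem_ne_zero_of_ne_bot this
    have hm' : Matrix.vecMul α n + Matrix.vecMul β u = 0 := hm
    refine ⟨α, β, fun hβ => hne ?_, fun x => ?_⟩
    · rw [hβ, Matrix.zero_vecMul, add_zero] at hm'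
      have := Matrix.vecMul_injective_iff.2 hn (hm'.trans (Matrix.zero_vecMul n).symm)
      rw [this, hβ]; rfl
    · rw [Matrix.dotProduct_mulVec, Matrix.dotProduct_mulVec, ← add_dotProduct, hm',
        zero_dotProduct]
  by_cases hαβ : LinearIndependent ℂ ![α, β]
  · have hc0 : α ⨯₃ β ≠ 0 := crossProduct_ne_zero_iff_linearIndependent.2 hαβ
    obtain ⟨v, hv, hker⟩ := exists_linearIndependent_ker (r := 2) (m := 3) (n := 5) (by norm_num)
      (Matrix.of ![Matrix.vecMul α n, Matrix.vecMul β n, Matrix.vecMul α u]).mulVecLin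
    have hv1 : ∀ i, α ⬝ᵥ n.mulVec (v i) = 0 := fun i => by
      rw [Matrix.dotProduct_mulVec]; exact congrFun (hker i) 0
    have hv2 : ∀ i, β ⬝ᵥ n.mulVec (v i) = 0 := fun i => by
      rw [Matrix.dotProduct_mulVec]; exact congrFun (hker i) 1
    have hv3 : ∀ i, α ⬝ᵥ u.mulVec (v i) = 0 := fun i => by
      rw [Matrix.dotProduct_mulVec]; exact congrFun (hker i) 2
    have hv4 : ∀ i, β ⬝ᵥ u.mulVec (v i) = 0 := fun i => by
      simpa [hv1] using hrel (v i)
    refine hst.not_singular_line hA v hv (α ⨯₃ β) hc0 (fun i => ?_) fun r i j => ?_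
    · refine mulVec_eq_zero_of_add (pencil_isSymm hA _) fun y => ?_
      rw [hu, hu, cross_dot_cross, cross_dot_cross]
      simp only [Matrix.mulVec_add, dotProduct_add, hv1, hv2, hv3, hv4, add_zero]
    · have hvan : ∀ x, α ⬝ᵥ n.mulVec x = 0 → β ⬝ᵥ n.mulVec x = 0 → α ⬝ᵥ u.mulVec x = 0 →
          β ⬝ᵥ u.mulVec x = 0 → x ⬝ᵥ (pencil A r).mulVec x = 0 := by
        intro x h1 h2 h3 h4
        rw [hu, cross_eq_zero_of_dotProduct_eq_zero hαβ h1 h2 h3 h4, dotProduct_zero]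
      have e1 := hvan (v i + v j) (by simp [Matrix.mulVec_add, hv1])
        (by simp [Matrix.mulVec_add, hv2]) (by simp [Matrix.mulVec_add, hv3])
        (by simp [Matrix.mulVec_add, hv4])
      have e2 := hvan _ (hv1 i) (hv2 i) (hv3 i) (hv4 i)
      have e3 := hvan _ (hv1 j) (hv2 j) (hv3 j) (hv4 j)
      rw [Matrix.mulVec_add, add_dotProduct, dotProduct_add, dotProduct_add, e2, e3,
        dotProduct_mulVec_comm (pencil_isSymm hA r) (v j)] at e1
      linear_combination e1 / 2
  · obtain ⟨c, hc⟩ : ∃ c : ℂ, c • β = α := by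
      by_contra! h
      exact hαβ (LinearIndependent.pair_symm_iff.1 ((LinearIndependent.pair_iff' hβ).2 h))
    obtain ⟨w, hw⟩ : ∃ w : Fin 3 → ℂ, w ⨯₃ β ≠ 0 := by
      by_contra! h
      have h1 := h (Pi.single 0 1)
      have h2 := h (Pi.single 1 1)
      simp [cross_apply] at h1 h2
      refine hβ ?_
      funext i
      fin_cases i <;> simp [h1, h2]
    have hprod : ∀ x, x ⬝ᵥ (pencil A (w ⨯₃ β)).mulVec x =
        -((Matrix.vecMul w u + c • Matrix.vecMul w n) ⬝ᵥ x * (Matrix.vecMul β n ⬝ᵥ x)) := by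
      intro x
      have h1 := hrel x
      rw [hu, cross_dot_cross, add_dotProduct, smul_dotProduct, ← Matrix.dotProduct_mulVec,
        ← Matrix.dotProduct_mulVec, ← Matrix.dotProduct_mulVec]
      rw [← hc, smul_dotProduct] at h1
      simp only [smul_eq_mul] at *
      linear_combination (w ⬝ᵥ n.mulVec x) * h1
    set a := Matrix.vecMul w u + c • Matrix.vecMul w n
    set b := Matrix.vecMul β n
    have hpoly : quadPoly (pencil A (w ⨯₃ β)) = -(linForm a * linForm b) := by
      refine MvPolynomial.funext fun x => ?_
      rw [eval_quadPoly, hprod, map_neg, map_mul, eval_linForm, eval_linForm]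
    have hne : quadPoly (pencil A (w ⨯₃ β)) ≠ 0 := fun h =>
      hst.pencil_ne_zero hw (quadPoly_injective_of_isSymm (pencil_isSymm hA _) h)
    have hz : aeval η (linForm a) * aeval η (linForm b) = 0 := by
      have := congrArg (aeval η) hpoly
      rw [quadPoly_pencil] at this
      simpa [h0] using this
    rcases mul_eq_zero.1 hz with h | h
    · have := eq_zero_of_aeval_linForm hli h
      exact hne (by rw [hpoly, this]; simp [linForm])
    · have := eq_zero_of_aeval_linForm hli h
      exact hne (by rw [hpoly, this]; simp [linForm])

end

lemma MatStable.false_of_trdeg_gt {A : Fin 3 → Matrix (Fin 5) (Fin 5) ℂ}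
    (hst : MatStable A) (hA : ∀ k, (A k).IsSymm) {D : Type} [CommRing D] [IsDomain D] [Algebra ℂ D]
    {ξ : Fin 5 → D} (hξ : Algebra.adjoin ℂ (Set.range ξ) = ⊤) (htr : 2 < Algebra.trdeg ℂ D)
    (h0 : ∀ k, aeval ξ (quadPoly (A k)) = 0) {t : Fin 3 → ℂ} (ht : t ≠ 0) {v : Fin 5 → ℂ}
    (hv : v ≠ 0) (hker : (pencil A t).mulVec v = 0)
    (hbase : ∀ r, v ⬝ᵥ (pencil A r).mulVec v = 0) : False := by
  have hξli := hst.linearIndependent_of_trdeg_gt hA hξ htr h0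
  obtain ⟨S, hS, hSt⟩ := exists_linearIndependent_extension (n := 3) (m := 1) (by norm_num)
    (fun _ => t) (LinearIndependent.of_subsingleton 0 ht)
  obtain ⟨W, hW, hWv⟩ := exists_linearIndependent_extension (n := 5) (m := 1) (by norm_num)
    (fun _ => v) (LinearIndependent.of_subsingleton 0 hv)
  replace hSt : S 0 = t := hSt 0
  replace hWv : W 0 = v := hWv 0
  obtain ⟨η, hη, hηξ⟩ := exists_linearIndependent_coordinates hξli (W := Matrix.of W) hW
  set B : Fin 3 → Matrix (Fin 5) (Fin 5) ℂ :=
    fun k => Matrix.of W * pencil A (S k) * (Matrix.of W).transpose with hB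
  have hent : ∀ k i j, B k i j = W i ⬝ᵥ (pencil A (S k)).mulVec (W j) := fun k i j =>
    congr_apply _ _ i j
  have hstB : MatStable B := hst.congr (S := Matrix.of S) (W := Matrix.of W) hS hW
  have hsymB : ∀ k, (B k).IsSymm := fun k => isSymm_congr (pencil_isSymm hA _) _
  have hBη : ∀ k, aeval η (quadPoly (B k)) = 0 := fun k => by
    rw [hB, aeval_quadPoly_congr _ _ hηξ, quadPoly_pencil]
    simp [h0]
  have hrow : ∀ j, B 0 0 j = 0 := fun j => by
    rw [hent, dotProduct_mulVec_comm (pencil_isSymm hA _), hSt, hWv, hker, dotProduct_zero]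
  obtain ⟨n, hn, hsyz⟩ := hstB.exists_linear_syzygy hsymB hrow
    (fun k => by rw [hent, hWv, hbase]) (adjoin_eq_top_of_forall_eq_sum hηξ hξ) hη htr hBη
  exact hstB.false_of_linear_syzygy hsymB hη hBη (n := Matrix.of n) hn hsyz

lemma eval_netDisc (Q1 Q2 Q3 : Quin) (s : Fin 3 → ℂ) : eval s (netDisc Q1 Q2 Q3) =
    (pencil ![quadMatrix Q1, quadMatrix Q2, quadMatrix Q3] s).det := by
  rw [netDisc, RingHom.map_det]
  congr 1
  ext i j
  simp [pencil, Fin.sum_univ_three, Matrix.add_apply, mul_comm]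

/-- If the discriminant of a semistable net is not squarefree, then the
curve cut out by the net is non-reduced (its ideal is not radical). -/
theorem nonreduced_of_disc_not_squarefree (Λ : Submodule ℂ Quin) (hΛ : IsNet Λ)
    (hss : Semistable Λ)
    (Q1 Q2 Q3 : Quin) (hQ1 : Q1 ∈ Λ) (hQ2 : Q2 ∈ Λ) (hQ3 : Q3 ∈ Λ)
    (hli : LinearIndependent ℂ ![Q1, Q2, Q3])
    (hspan : Submodule.span ℂ {Q1, Q2, Q3} = Λ)
    (hnsqf : ∃ p : MvPolynomial (Fin 3) ℂ, 0 < p.totalDegree ∧ p ^ 2 ∣ netDisc Q1 Q2 Q3) :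
    ¬ (Ideal.span {Q1, Q2, Q3} : Ideal Quin).IsRadical := by

  intro hI
  set A : Fin 3 → Matrix (Fin 5) (Fin 5) ℂ :=
    ![quadMatrix Q1, quadMatrix Q2, quadMatrix Q3] with hAdef
  have hA : ∀ k, (A k).IsSymm := by
    intro k
    fin_cases k <;> exact quadMatrix_isSymm _
  have hrange : Set.range (fun k => quadPoly (A k)) = {Q1, Q2, Q3} := by
    have : (fun k => quadPoly (A k)) = ![Q1, Q2, Q3] := by
      funext k
      fin_cases k
      · exact quadPoly_quadMatrix (hΛ.2 _ hQ1)
      · exact quadPoly_quadMatrix (hΛ.2 _ hQ2)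
      · exact quadPoly_quadMatrix (hΛ.2 _ hQ3)
    rw [this, Matrix.range_cons, Matrix.range_cons_cons_empty]
    rfl
  have hst : MatStable A := matStable_of_semistable hss A (by rw [hrange, hspan])
  obtain ⟨p, hp, q, hq⟩ := hnsqf
  have hdet : ∀ s, (pencil A s).det = eval s p ^ 2 * eval s q := fun s => by
    rw [hAdef, ← eval_netDisc, hq, map_mul, map_pow]
  obtain ⟨T, hT0, hT⟩ := exists_linearIndependent_zeros hp
  have hTne : ∀ n, T n ≠ 0 := fun n => (hT n (n + 1) n.succ_ne_self.symm).ne_zero 0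
  choose v hv0 hker hbase using fun n => exists_singular_base_point hA hdet (hTne n) (hT0 n)
  rw [← hrange] at hI
  obtain ⟨P, hP, htr⟩ := hst.exists_trdeg_gt hA hI hT hv0 hker hbase
  have hprime : P.IsPrime := hP.isPrime
  have haeval : ∀ f : Quin,
      aeval (fun i => Ideal.Quotient.mk P (X i)) f = Ideal.Quotient.mk P f := by
    intro f
    have := comp_aeval_apply (R := ℂ) (X : Fin 5 → Quin) (Ideal.Quotient.mkₐ ℂ P) f
    rw [aeval_X_left_apply] at this
    exact this.symm
  refine hst.false_of_trdeg_gt hA (ξ := fun i => Ideal.Quotient.mk P (X i)) ?_ htr (fun k => ?_)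
    (hTne 0) (hv0 0) (hker 0) (hbase 0)
  · rw [Algebra.adjoin_range_eq_range_aeval, eq_top_iff]
    intro x _
    obtain ⟨f, rfl⟩ := Ideal.Quotient.mk_surjective x
    exact ⟨f, haeval f⟩
  · rw [haeval, Ideal.Quotient.eq_zero_iff_mem]
    exact hP.1.2 (Ideal.subset_span (Set.mem_range_self k))
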